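/- (Tangential second derivative bound on the boundary.) For every K > 0 there exist constants ε > 0 and C₂₇ > 0, depending only on n, Ω, Ω̃, h, h̃, θ, θ̃ and K, with the following property. Let f ∈ 𝒜 with ‖f‖_{C²(Ω̄ × closure(Ω̃))} ≤ K satisfy condition (OSC), sup |D_x f| ≤ ε and sup |D_{xp} f| ≤ ε. Let u be a smooth uniformly convex solution of the second boundary value problem with data (f, c) and ũ its Legendre transform. Then for every y ∈ ∂Ω̃ and every unit vector ς ∈ ℝⁿ with ⟨ς, ν̃(y)⟩ = 0 (a tangential direction, where ν̃(y) = ∇h(y)), one has ⟨D²ũ(y)·ς, ς⟩ ≤ C₂₇. -/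

import Mathlib

open Set MeasureTheory Matrix
open scoped Topology RealInnerProductSpace NNReal

noncomputable section

abbrev Euc (n : ℕ) := EuclideanSpace ℝ (Fin n)

variable {n : ℕ}

/-- Hessian matrix of `u` at `x`. -/
def Hess (u : Euc n → ℝ) (x : Euc n) : Matrix (Fin n) (Fin n) ℝ :=
  fun i j => iteratedFDeriv ℝ 2 u x ![EuclideanSpace.single i 1, EuclideanSpace.single j 1]

/-- `A ≤ B` in the sense of symmetric matrices. -/
def MatLE (A B : Matrix (Fin n) (Fin n) ℝ) : Prop := (B - A).PosSemidef

/-- The Minkowski mean-curvature operator `div (∇u / √(1 - |∇u|²))`. -/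
def MinkDiv (u : Euc n → ℝ) (x : Euc n) : ℝ :=
  ∑ i, fderiv ℝ (fun y => (Real.sqrt (1 - ‖gradient u y‖ ^ 2))⁻¹ * gradient u y i) x
    (EuclideanSpace.single i 1)

/-- The Euclidean mean-curvature operator `div (∇u / √(1 + |∇u|²))`. -/
def EucDiv (u : Euc n → ℝ) (x : Euc n) : ℝ :=
  ∑ i, fderiv ℝ (fun y => (Real.sqrt (1 + ‖gradient u y‖ ^ 2))⁻¹ * gradient u y i) x
    (EuclideanSpace.single i 1)

/-- `S(p) = (1/v)(Iₙ + p pᵀ / v²)`, `v = √(1-|p|²)`. -/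
def Smat (p : Euc n) : Matrix (Fin n) (Fin n) ℝ :=
  (Real.sqrt (1 - ‖p‖ ^ 2))⁻¹ •
    ((1 : Matrix (Fin n) (Fin n) ℝ) +
      (1 - ‖p‖ ^ 2)⁻¹ • Matrix.vecMulVec (fun i => p i) (fun j => p j))

/-- `B(p) = Iₙ + p pᵀ / (v (1 + v))`, `v = √(1-|p|²)`. -/
def Bmat (p : Euc n) : Matrix (Fin n) (Fin n) ℝ :=
  (1 : Matrix (Fin n) (Fin n) ℝ) +
    (Real.sqrt (1 - ‖p‖ ^ 2) * (1 + Real.sqrt (1 - ‖p‖ ^ 2)))⁻¹ •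
      Matrix.vecMulVec (fun i => p i) (fun j => p j)

/-- `A(x) = (1/v)·B(∇u)·D²u·B(∇u)`: its eigenvalues are the principal curvatures. -/
def Amat (u : Euc n → ℝ) (x : Euc n) : Matrix (Fin n) (Fin n) ℝ :=
  (Real.sqrt (1 - ‖gradient u x‖ ^ 2))⁻¹ •
    (Bmat (gradient u x) * Hess u x * Bmat (gradient u x))

/-- supremum of the quadratic form of `A` over the unit sphere (the operator
norm / largest eigenvalue for a positive semidefinite symmetric `A`). -/
def quadSup (A : Matrix (Fin n) (Fin n) ℝ) : ℝ :=
  ⨆ ξ : Metric.sphere (0 : Euc n) 1,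
    (fun i => (ξ : Euc n) i) ⬝ᵥ A.mulVec (fun i => (ξ : Euc n) i)

/-- The domains `Ω = {h̃ > 0}`, `Ω̃ = {h > 0}` are bounded uniformly convex domains
with smooth boundary, described by the defining functions `h̃` and `h`. -/
def DomainSetup (Ω Ωt : Set (Euc n)) (ht h : Euc n → ℝ) (θt θ : ℝ) : Prop :=
  IsOpen Ω ∧ IsOpen Ωt ∧ Bornology.IsBounded Ω ∧ Bornology.IsBounded Ωt ∧
  Ω.Nonempty ∧ Ωt.Nonempty ∧
  ContDiff ℝ (⊤ : ℕ∞) ht ∧ ContDiff ℝ (⊤ : ℕ∞) h ∧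
  Ω = {x | 0 < ht x} ∧ Ωt = {y | 0 < h y} ∧
  (∀ x ∈ frontier Ω, ‖gradient ht x‖ = 1) ∧
  (∀ y ∈ frontier Ωt, ‖gradient h y‖ = 1) ∧
  0 < θt ∧ 0 < θ ∧
  (∀ x : Euc n, MatLE (Hess ht x) ((-θt) • (1 : Matrix (Fin n) (Fin n) ℝ))) ∧
  (∀ y : Euc n, MatLE (Hess h y) ((-θ) • (1 : Matrix (Fin n) (Fin n) ℝ)))

/-- `f ∈ 𝒜`: `f` is `C²` on `Ω̄ × closure Ω̃` and concave in `x`. -/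
def InA (Ω Ωt : Set (Euc n)) (f : Euc n × Euc n → ℝ) : Prop :=
  ContDiffOn ℝ 2 f (closure Ω ×ˢ closure Ωt) ∧
  ∀ p ∈ closure Ωt, ConcaveOn ℝ (closure Ω) (fun x => f (x, p))

/-- Condition (OSC): `osc f ≤ (n/2)(|Ω̃|/|Ω|)^{1/n}`. -/
def OSCcond (Ω Ωt : Set (Euc n)) (f : Euc n × Euc n → ℝ) : Prop :=
  ∀ x ∈ closure Ω, ∀ y ∈ closure Ω, ∀ p ∈ closure Ωt, ∀ q ∈ closure Ωt,
    |f (x, p) - f (y, q)| ≤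
      ((n : ℝ) / 2) * ((volume Ωt).toReal / (volume Ω).toReal) ^ ((1 : ℝ) / n)

/-- `‖f‖_{C²(Ω̄ × closure Ω̃)} ≤ K`. -/
def C2Bound (Ω Ωt : Set (Euc n)) (f : Euc n × Euc n → ℝ) (K : ℝ) : Prop :=
  ContDiffOn ℝ 2 f (closure Ω ×ˢ closure Ωt) ∧
  ∀ z ∈ closure Ω ×ˢ closure Ωt,
    |f z| ≤ K ∧ ‖fderiv ℝ f z‖ ≤ K ∧ ‖iteratedFDeriv ℝ 2 f z‖ ≤ K

/-- `sup |D_x f| ≤ ε` on `Ω̄ × closure Ω̃`. -/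
def DxBound (Ω Ωt : Set (Euc n)) (f : Euc n × Euc n → ℝ) (ε : ℝ) : Prop :=
  ∀ x ∈ closure Ω, ∀ p ∈ closure Ωt, ‖fderiv ℝ (fun x' => f (x', p)) x‖ ≤ ε

/-- `sup |D_{xp} f| ≤ ε` on `Ω̄ × closure Ω̃`. -/
def DxpBound (Ω Ωt : Set (Euc n)) (f : Euc n × Euc n → ℝ) (ε : ℝ) : Prop :=
  ∀ x ∈ closure Ω, ∀ p ∈ closure Ωt,
    ‖fderiv ℝ (fun p' => fderiv ℝ (fun x' => f (x', p')) x) p‖ ≤ ε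

/-- A strictly convex solution of the second boundary value problem. -/
def IsStrictSol (Ω Ωt : Set (Euc n)) (f : Euc n × Euc n → ℝ) (c : ℝ) (u : Euc n → ℝ) : Prop :=
  ContDiffOn ℝ 2 u (closure Ω) ∧
  (∀ x ∈ closure Ω, (Hess u x).PosDef) ∧
  (∀ x ∈ closure Ω, ‖gradient u x‖ < 1) ∧
  (∀ x ∈ Ω, MinkDiv u x = f (x, gradient u x) + c) ∧
  gradient u '' Ω = Ωt

/-- A smooth uniformly convex solution of the second boundary value problem. -/
def IsSmoothSol (Ω Ωt : Set (Euc n)) (f : Euc n × Euc n → ℝ) (c : ℝ) (u : Euc n → ℝ) : Prop :=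
  ContDiffOn ℝ (⊤ : ℕ∞) u (closure Ω) ∧
  (∃ δ : ℝ, 0 < δ ∧ ∀ x ∈ closure Ω, MatLE (δ • (1 : Matrix (Fin n) (Fin n) ℝ)) (Hess u x)) ∧
  (∀ x ∈ closure Ω, ‖gradient u x‖ < 1) ∧
  (∀ x ∈ Ω, MinkDiv u x = f (x, gradient u x) + c) ∧
  gradient u '' Ω = Ωt

/-- A uniformly convex `C^{2}` solution of the second boundary value problem. -/
def IsUCSol (Ω Ωt : Set (Euc n)) (f : Euc n × Euc n → ℝ) (c : ℝ) (u : Euc n → ℝ) : Prop :=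
  ContDiffOn ℝ 2 u (closure Ω) ∧
  (∃ δ : ℝ, 0 < δ ∧ ∀ x ∈ closure Ω, MatLE (δ • (1 : Matrix (Fin n) (Fin n) ℝ)) (Hess u x)) ∧
  (∀ x ∈ closure Ω, ‖gradient u x‖ < 1) ∧
  (∀ x ∈ Ω, MinkDiv u x = f (x, gradient u x) + c) ∧
  gradient u '' Ω = Ωt

/-- A uniformly convex `C^{4,α}` solution of the second boundary value problem
for the Minkowski mean-curvature operator. -/
def IsC4Sol (Ω Ωt : Set (Euc n)) (f : Euc n × Euc n → ℝ) (c : ℝ) (u : Euc n → ℝ)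
    (α : ℝ) : Prop :=
  ContDiffOn ℝ 4 u (closure Ω) ∧
  (∃ C : ℝ≥0, HolderOnWith C (Real.toNNReal α) (fun x => iteratedFDeriv ℝ 4 u x) (closure Ω)) ∧
  (∃ δ : ℝ, 0 < δ ∧ ∀ x ∈ closure Ω, MatLE (δ • (1 : Matrix (Fin n) (Fin n) ℝ)) (Hess u x)) ∧
  (∀ x ∈ closure Ω, ‖gradient u x‖ < 1) ∧
  (∀ x ∈ Ω, MinkDiv u x = f (x, gradient u x) + c) ∧
  gradient u '' Ω = Ωt

/-- A uniformly convex `C^{4,α}` solution of the second boundary value problem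
for the Euclidean mean-curvature operator. -/
def IsC4SolE (Ω Ωt : Set (Euc n)) (f : Euc n × Euc n → ℝ) (c : ℝ) (u : Euc n → ℝ)
    (α : ℝ) : Prop :=
  ContDiffOn ℝ 4 u (closure Ω) ∧
  (∃ C : ℝ≥0, HolderOnWith C (Real.toNNReal α) (fun x => iteratedFDeriv ℝ 4 u x) (closure Ω)) ∧
  (∃ δ : ℝ, 0 < δ ∧ ∀ x ∈ closure Ω, MatLE (δ • (1 : Matrix (Fin n) (Fin n) ℝ)) (Hess u x)) ∧
  (∀ x ∈ Ω, EucDiv u x = f (x, gradient u x) + c) ∧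
  gradient u '' Ω = Ωt

/-- `ũ` is the Legendre transform of `u`. -/
def IsLegendre (Ω Ωt : Set (Euc n)) (u ut : Euc n → ℝ) : Prop :=
  ContDiffOn ℝ (⊤ : ℕ∞) ut (closure Ωt) ∧
  (∀ x ∈ closure Ω, ut (gradient u x) = ⟪x, gradient u x⟫ - u x) ∧
  (∀ x ∈ closure Ω, gradient ut (gradient u x) = x) ∧
  (∀ x ∈ closure Ω, Hess ut (gradient u x) = (Hess u x)⁻¹)

section Jets

variable {F E : Type*} [NormedAddCommGroup F] [NormedSpace ℝ F]
  [NormedAddCommGroup E] [NormedSpace ℝ E]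

/-- `φ` is twice differentiable at `0` with first derivative `a` and second derivative `b`. -/
def HasJet (φ : ℝ → F) (a b : F) : Prop :=
  ∃ φ' : ℝ → F, (∀ᶠ t in 𝓝 (0 : ℝ), HasDerivAt φ (φ' t) t) ∧ φ' 0 = a ∧ HasDerivAt φ' b 0

theorem HasJet.hasDerivAt {φ : ℝ → F} {a b : F} (hφ : HasJet φ a b) : HasDerivAt φ a 0 := by
  obtain ⟨φ', h1, rfl, -⟩ := hφ
  exact h1.self_of_nhds

theorem HasJet.isLocalMax {φ : ℝ → ℝ} {a b : ℝ} (hφ : HasJet φ a b) (hm : IsLocalMax φ 0) :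
    a = 0 ∧ b ≤ 0 := by
  have ha : a = 0 := hm.hasDerivAt_eq_zero hφ.hasDerivAt
  refine ⟨ha, ?_⟩
  obtain ⟨φ', h1, h2, h3⟩ := hφ
  by_contra! hb
  have hd : deriv φ =ᶠ[𝓝 0] φ' := by
    filter_upwards [h1] with t ht using ht.deriv
  have hdd : deriv (deriv φ) 0 = b := by rw [hd.deriv_eq, h3.deriv]
  have hmin : IsLocalMin φ 0 :=
    isLocalMin_of_deriv_deriv_pos (by rw [hdd]; exact hb) (by rw [hd.eq_of_nhds, h2, ha])
      h1.self_of_nhds.continuousAt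
  have hc : φ =ᶠ[𝓝 0] fun _ => φ 0 := by
    filter_upwards [hm, hmin] with t h4 h5 using le_antisymm h4 h5
  have h0 : deriv φ =ᶠ[𝓝 0] fun _ => 0 := by
    have := hc.deriv
    simpa using this
  rw [h0.deriv_eq] at hdd
  simp at hdd
  linarith

theorem HasJet.add {φ ψ : ℝ → F} {a b c d : F} (hφ : HasJet φ a b) (hψ : HasJet ψ c d) :
    HasJet (fun t => φ t + ψ t) (a + c) (b + d) := by
  obtain ⟨φ', h1, rfl, h3⟩ := hφ
  obtain ⟨ψ', k1, rfl, k3⟩ := hψ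
  refine ⟨fun t => φ' t + ψ' t, ?_, rfl, h3.add k3⟩
  filter_upwards [h1, k1] with t h k using h.add k

theorem HasJet.clm {φ : ℝ → F} {a b : F} (hφ : HasJet φ a b) (L : F →L[ℝ] E) :
    HasJet (fun t => L (φ t)) (L a) (L b) := by
  obtain ⟨φ', h1, rfl, h3⟩ := hφ
  refine ⟨fun t => L (φ' t), ?_, rfl, L.hasFDerivAt.comp_hasDerivAt 0 h3⟩
  filter_upwards [h1] with t h using L.hasFDerivAt.comp_hasDerivAt t h

theorem HasJet.const_smul {φ : ℝ → F} {a b : F} (hφ : HasJet φ a b) (r : ℝ) :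
    HasJet (fun t => r • φ t) (r • a) (r • b) :=
  hφ.clm (r • ContinuousLinearMap.id ℝ F)

theorem HasJet.const_mul {φ : ℝ → ℝ} {a b : ℝ} (hφ : HasJet φ a b) (r : ℝ) :
    HasJet (fun t => r * φ t) (r * a) (r * b) := by
  simpa using hφ.const_smul r

theorem hasJet_const (x : F) : HasJet (fun _ => x) 0 0 :=
  ⟨fun _ => 0, Filter.Eventually.of_forall fun t => hasDerivAt_const t x, rfl,
    hasDerivAt_const 0 0⟩

theorem HasJet.sub {φ ψ : ℝ → F} {a b c d : F} (hφ : HasJet φ a b) (hψ : HasJet ψ c d) :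
    HasJet (fun t => φ t - ψ t) (a - c) (b - d) := by
  simpa [sub_eq_add_neg] using hφ.add (hψ.const_smul (-1))

theorem HasJet.sum {ι : Type*} (s : Finset ι) {φ : ι → ℝ → F} {a b : ι → F}
    (hφ : ∀ i, HasJet (φ i) (a i) (b i)) :
    HasJet (fun t => ∑ i ∈ s, φ i t) (∑ i ∈ s, a i) (∑ i ∈ s, b i) := by
  classical
  induction s using Finset.induction_on with
  | empty => simpa using hasJet_const (0 : F)
  | insert i s hi ih => simpa [Finset.sum_insert hi] using (hφ i).add ih

theorem hasJet_line (y v : F) : HasJet (fun t => y + t • v) v 0 := by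
  refine ⟨fun _ => v, Filter.Eventually.of_forall fun t => ?_, rfl, hasDerivAt_const 0 v⟩
  simpa using ((hasDerivAt_id t).smul_const v).const_add y

/-- Second order chain rule. -/
theorem HasJet.comp {g : F → E} {φ : ℝ → F} {a b : F} (hφ : HasJet φ a b)
    (hg : ContDiffAt ℝ 2 g (φ 0)) :
    HasJet (fun t => g (φ t)) (fderiv ℝ g (φ 0) a)
      (fderiv ℝ (fderiv ℝ g) (φ 0) a a + fderiv ℝ g (φ 0) b) := by
  have hc : ContinuousAt φ 0 := hφ.hasDerivAt.continuousAt
  have hφ0 := hφ.hasDerivAt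
  obtain ⟨φ', h1, h2, h3⟩ := hφ
  refine ⟨fun t => fderiv ℝ g (φ t) (φ' t), ?_, by simp [h2], ?_⟩
  · have hd : ∀ᶠ z in 𝓝 (φ 0), DifferentiableAt ℝ g z := by
      filter_upwards [hg.eventually (by simp)] with z hz using hz.differentiableAt (by norm_num)
    filter_upwards [h1, hc.eventually hd] with t h4 h5
    exact h5.hasFDerivAt.comp_hasDerivAt t h4
  · have h4 : DifferentiableAt ℝ (fderiv ℝ g) (φ 0) :=
      (hg.fderiv_right (m := 1) (by norm_num)).differentiableAt (by norm_num)
    have h5 : HasDerivAt (fun t => fderiv ℝ g (φ t)) (fderiv ℝ (fderiv ℝ g) (φ 0) a) 0 :=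
      h4.hasFDerivAt.comp_hasDerivAt 0 hφ0
    have := h5.clm_apply h3
    rwa [h2] at this

theorem hasJet_comp_line {g : F → E} {y : F} (hg : ContDiffAt ℝ 2 g y) (v : F) :
    HasJet (fun t => g (y + t • v)) (fderiv ℝ g y v) (fderiv ℝ (fderiv ℝ g) y v v) := by
  have := (hasJet_line y v).comp (g := g) (by simpa using hg)
  simpa using this

end Jets

section JetsInner

variable {H : Type*} [NormedAddCommGroup H] [InnerProductSpace ℝ H]

theorem HasJet.inner_const {φ : ℝ → H} {a b : H} (hφ : HasJet φ a b) (e : H) :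
    HasJet (fun t => ⟪e, φ t⟫) ⟪e, a⟫ ⟪e, b⟫ :=
  hφ.clm (innerSL ℝ e)

theorem HasJet.norm_sq {φ : ℝ → H} {a b : H} (hφ : HasJet φ a b) :
    HasJet (fun t => ‖φ t‖ ^ 2) (2 * ⟪φ 0, a⟫) (2 * (‖a‖ ^ 2 + ⟪φ 0, b⟫)) := by
  have hφ0 := hφ.hasDerivAt
  obtain ⟨φ', h1, h2, h3⟩ := hφ
  refine ⟨fun t => 2 * ⟪φ t, φ' t⟫, ?_, by simp [h2], ?_⟩
  · filter_upwards [h1] with t h using h.norm_sq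
  · have := (hφ0.inner ℝ h3).const_mul 2
    rw [h2, real_inner_self_eq_norm_sq, add_comm] at this
    exact this

end JetsInner

section Barriers

variable {H : Type*} [NormedAddCommGroup H] [InnerProductSpace ℝ H]

/-- `h` is a uniformly concave defining function of `U` with gradient `ν`, and all relevant
derivatives are bounded by `k`. -/
structure Barrier (U : Set H) (h : H → ℝ) (ν : H → H) (θ k : ℝ) : Prop where
  isOpen : IsOpen U
  isCompact : IsCompact (closure U)
  mem_iff : ∀ y, y ∈ U ↔ 0 < h y
  hasFDerivAt : ∀ y, HasFDerivAt h (innerSL ℝ (ν y)) y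
  smooth : ContDiff ℝ 2 ν
  concave : ∀ y v, ⟪fderiv ℝ ν y v, v⟫ ≤ -θ * ‖v‖ ^ 2
  unit : ∀ y ∈ frontier U, ‖ν y‖ = 1
  bound_norm : ∀ y ∈ closure U, ‖y‖ ≤ k
  bound : ∀ y ∈ closure U, |h y| ≤ k
  bound_grad : ∀ y ∈ closure U, ‖ν y‖ ≤ k
  bound_hess : ∀ y ∈ closure U, ‖fderiv ℝ ν y‖ ≤ k
  bound_third : ∀ y ∈ closure U, ‖fderiv ℝ (fderiv ℝ ν) y‖ ≤ k
  lipschitz : ∀ y ∈ closure U, ∀ z ∈ closure U, ‖ν y - ν z‖ ≤ k * ‖y - z‖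

variable {U : Set H} {h : H → ℝ} {ν : H → H} {θ k : ℝ}

theorem HasJet.comp_grad (hgrad : ∀ y, HasFDerivAt h (innerSL ℝ (ν y)) y)
    (hν : Differentiable ℝ ν) {φ : ℝ → H} {a b : H} (hφ : HasJet φ a b) :
    HasJet (fun t => h (φ t)) ⟪ν (φ 0), a⟫ (⟪fderiv ℝ ν (φ 0) a, a⟫ + ⟪ν (φ 0), b⟫) := by
  have hφ0 := hφ.hasDerivAt
  obtain ⟨φ', h1, h2, h3⟩ := hφ
  refine ⟨fun t => ⟪ν (φ t), φ' t⟫, ?_, by simp [h2], ?_⟩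
  · filter_upwards [h1] with t ht
    exact (hgrad (φ t)).comp_hasDerivAt t ht
  · have h4 : HasDerivAt (fun t => ν (φ t)) (fderiv ℝ ν (φ 0) a) 0 :=
      (hν (φ 0)).hasFDerivAt.comp_hasDerivAt 0 hφ0
    have := h4.inner ℝ h3
    rwa [h2, add_comm] at this

namespace Barrier

theorem differentiable (B : Barrier U h ν θ k) : Differentiable ℝ ν :=
  B.smooth.differentiable (by norm_num)

theorem continuous (B : Barrier U h ν θ k) : Continuous h :=
  continuous_iff_continuousAt.2 fun y => (B.hasFDerivAt y).continuousAt

theorem eq_zero_of_frontier (B : Barrier U h ν θ k) {y : H} (hy : y ∈ frontier U) : h y = 0 := by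
  have h1 : ¬ 0 < h y := by
    rw [← B.mem_iff, ← B.isOpen.interior_eq]
    exact hy.2
  have h2 : closure U ⊆ {z | 0 ≤ h z} :=
    closure_minimal (fun z hz => ((B.mem_iff z).1 hz).le) (isClosed_le continuous_const B.continuous)
  exact le_antisymm (not_lt.1 h1) (h2 hy.1)

theorem mem_or_frontier (B : Barrier U h ν θ k) {y : H} (hy : y ∈ closure U) :
    y ∈ U ∨ y ∈ frontier U := by
  by_cases hU : y ∈ U
  · exact Or.inl hU
  · exact Or.inr ⟨hy, by rwa [B.isOpen.interior_eq]⟩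

theorem nonneg (B : Barrier U h ν θ k) {y : H} (hy : y ∈ closure U) : 0 ≤ h y := by
  rcases B.mem_or_frontier hy with h1 | h1
  · exact ((B.mem_iff y).1 h1).le
  · exact (B.eq_zero_of_frontier h1).ge

theorem eventually_mem (B : Barrier U h ν θ k) {y e : H} (hy : y ∈ frontier U)
    (he : 0 < ⟪ν y, e⟫) : ∀ᶠ t in 𝓝[>] (0 : ℝ), y + t • e ∈ U := by
  have h1 : HasDerivAt (fun t : ℝ => h (y + t • e)) ⟪ν y, e⟫ 0 := by
    simpa using ((hasJet_line y e).comp_grad B.hasFDerivAt B.differentiable).hasDerivAt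
  have h2 := (hasDerivAt_iff_tendsto_slope.1 h1).mono_left
    (nhdsWithin_mono (0 : ℝ) (fun t (ht : 0 < t) => ht.ne' : Ioi (0 : ℝ) ⊆ {0}ᶜ))
  filter_upwards [h2.eventually (lt_mem_nhds he), self_mem_nhdsWithin] with t h3 h4
  have h4 : 0 < t := h4
  rw [B.mem_iff]
  simp only [slope, vsub_eq_sub, sub_zero, zero_smul, add_zero, B.eq_zero_of_frontier hy,
    smul_eq_mul] at h3
  exact pos_of_mul_pos_right h3 (by positivity)

theorem fderivWithin_nonneg (B : Barrier U h ν θ k) {y e : H} (hy : y ∈ frontier U)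
    (he : 0 < ⟪ν y, e⟫) {φ : H → ℝ} {φ' : H →L[ℝ] ℝ}
    (hφ : HasFDerivWithinAt φ φ' (closure U) y) (hpos : ∀ z ∈ closure U, 0 ≤ φ z)
    (h0 : φ y = 0) : 0 ≤ φ' e := by
  have hm : IsLocalMinOn φ (closure U) y := by
    filter_upwards [self_mem_nhdsWithin] with z hz
    rw [h0]; exact hpos z hz
  refine hm.hasFDerivWithinAt_nonneg hφ (mem_posTangentConeAt_of_frequently_mem ?_)
  refine Filter.Eventually.frequently ?_
  filter_upwards [B.eventually_mem hy he] with t ht using subset_closure ht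

/-- A nonnegative function vanishing at a boundary point has there a gradient which is a
nonnegative multiple of the inner normal. -/
theorem exists_eq_smul (B : Barrier U h ν θ k) {y g : H} (hy : y ∈ frontier U) {φ : H → ℝ}
    (hφ : HasFDerivWithinAt φ (innerSL ℝ g) (closure U) y)
    (hpos : ∀ z ∈ closure U, 0 ≤ φ z) (h0 : φ y = 0) : ∃ t : ℝ, 0 ≤ t ∧ g = t • ν y := by
  have key : ∀ e, 0 < ⟪ν y, e⟫ → 0 ≤ ⟪g, e⟫ := fun e he => by
    simpa using B.fderivWithin_nonneg hy he hφ hpos h0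
  have hν : ⟪ν y, ν y⟫ = (1 : ℝ) := by rw [real_inner_self_eq_norm_sq, B.unit y hy]; norm_num
  have h1 := key (ν y) (by rw [hν]; norm_num)
  refine ⟨⟪g, ν y⟫, h1, ?_⟩
  set w := g - ⟪g, ν y⟫ • ν y with hw
  have hwν : ⟪ν y, w⟫ = (0 : ℝ) := by
    rw [hw, inner_sub_right, inner_smul_right, hν, real_inner_comm]; ring
  have hgw : ⟪g, w⟫ = ‖w‖ ^ 2 := by
    rw [← real_inner_self_eq_norm_sq]
    nth_rewrite 2 [hw]
    rw [inner_sub_left, inner_smul_left, hwν]; simp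
  have h2 : ‖w‖ ^ 2 ≤ 0 := by
    refine le_of_forall_pos_le_add fun η hη => ?_
    have hs : 0 < η / (1 + ⟪g, ν y⟫) := by positivity
    have h3 := key (-w + (η / (1 + ⟪g, ν y⟫)) • ν y) (by
      rw [inner_add_right, inner_neg_right, hwν, inner_smul_right, hν]; simpa using hs)
    rw [inner_add_right, inner_neg_right, hgw, inner_smul_right] at h3
    have h4 : η / (1 + ⟪g, ν y⟫) * ⟪g, ν y⟫ ≤ η := by
      rw [div_mul_eq_mul_div, div_le_iff₀ (by positivity)]
      nlinarith
    linarith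
  have h5 : w = 0 := by
    have : ‖w‖ = 0 := by nlinarith [norm_nonneg w]
    simpa using this
  exact sub_eq_zero.1 h5

/-- A function which is nonpositive on the boundary and has no interior maximum is nonpositive. -/
theorem nonpos_of_no_max (B : Barrier U h ν θ k) {φ : H → ℝ} (hc : ContinuousOn φ (closure U))
    (hf : ∀ y ∈ frontier U, φ y ≤ 0) (hU : ∀ y ∈ U, ¬ IsLocalMax φ y) :
    ∀ y ∈ closure U, φ y ≤ 0 := by
  intro y hy
  obtain ⟨z, hz, hzm⟩ := B.isCompact.exists_isMaxOn ⟨y, hy⟩ hc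
  rcases B.mem_or_frontier hz with h1 | h1
  · refine absurd ?_ (hU z h1)
    filter_upwards [B.isOpen.mem_nhds h1] with w hw using hzm (subset_closure hw)
  · exact (hzm hy).trans (hf z h1)

end Barrier

theorem IsLocalMax.comp_line {F : Type*} [NormedAddCommGroup F] [NormedSpace ℝ F] {φ : F → ℝ}
    {y : F} (hφ : IsLocalMax φ y) (v : F) : IsLocalMax (fun t : ℝ => φ (y + t • v)) 0 := by
  have hc : ContinuousAt (fun t : ℝ => y + t • v) 0 := by fun_prop
  have h1 : ∀ᶠ z in 𝓝 ((fun t : ℝ => y + t • v) 0), φ z ≤ φ y := by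
    simpa [IsLocalMax, IsMaxFilter] using hφ
  filter_upwards [hc.eventually h1] with t ht
  simpa using ht

/-- At an interior maximum the value of an elliptic operator in nondivergence form is
nonpositive. -/
theorem IsLocalMax.sum_jet_nonpos {F ι : Type*} [NormedAddCommGroup F] [NormedSpace ℝ F]
    [Fintype ι] {φ : F → ℝ} {y : F} (hφ : IsLocalMax φ y) {p q : F → ℝ}
    (hj : ∀ v, HasJet (fun t : ℝ => φ (y + t • v)) (p v) (q v)) (ξ : ι → F) (b : F) :
    ∑ i, q (ξ i) + p b ≤ 0 := by
  have h1 : ∑ i, q (ξ i) ≤ 0 :=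
    Finset.sum_nonpos fun i _ => ((hj (ξ i)).isLocalMax (hφ.comp_line (ξ i))).2
  have h2 := ((hj b).isLocalMax (hφ.comp_line b)).1
  linarith

/-- Quadratic form bound for a nonnegative symmetric operator gives a norm bound. -/
theorem norm_apply_le_of_quadratic {A : H →L[ℝ] H} {M : ℝ} (hM : 0 ≤ M)
    (hsym : ∀ v w, ⟪A v, w⟫ = ⟪v, A w⟫) (hpos : ∀ v, 0 ≤ ⟪A v, v⟫)
    (hle : ∀ v, ⟪A v, v⟫ ≤ M * ‖v‖ ^ 2) (v : H) : ‖A v‖ ≤ M * ‖v‖ := by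
  have h1 : ∀ t : ℝ, 0 ≤ ⟪A v, v⟫ - 2 * t * ‖A v‖ ^ 2 + t ^ 2 * ⟪A (A v), A v⟫ := fun t => by
    have h2 := hpos (v - t • A v)
    have e : ⟪A (A v), v⟫ = ‖A v‖ ^ 2 := by rw [hsym, real_inner_self_eq_norm_sq]
    simp only [map_sub, map_smul, inner_sub_left, inner_sub_right, inner_smul_left,
      inner_smul_right, real_inner_self_eq_norm_sq, e] at h2
    simp at h2
    nlinarith
  have h3 : ‖A v‖ ^ 2 ≤ (M * ‖v‖) ^ 2 := by
    rcases hM.eq_or_lt with h0 | h0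
    · have h4 := h1 1
      have h5 := hle v
      have h6 := hle (A v)
      rw [← h0] at *
      nlinarith
    · have h4 := h1 M⁻¹
      have h5 := hle v
      have h6 := hle (A v)
      have h7 : M⁻¹ ^ 2 * ⟪A (A v), A v⟫ ≤ M⁻¹ ^ 2 * (M * ‖A v‖ ^ 2) := by gcongr
      have h8 : M⁻¹ ^ 2 * (M * ‖A v‖ ^ 2) = M⁻¹ * ‖A v‖ ^ 2 := by field_simp
      have h9 : M⁻¹ * ‖A v‖ ^ 2 ≤ M * ‖v‖ ^ 2 := by nlinarith
      have h10 : M * (M⁻¹ * ‖A v‖ ^ 2) ≤ M * (M * ‖v‖ ^ 2) := by gcongr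
      have h11 : M * (M⁻¹ * ‖A v‖ ^ 2) = ‖A v‖ ^ 2 := by field_simp
      nlinarith
  exact (abs_le_of_sq_le_sq' h3 (by positivity)).2

end Barriers

section Dual

variable {H ι : Type*} [NormedAddCommGroup H] [InnerProductSpace ℝ H] [Fintype ι]

/-- The structure of the dual problem: `G` is the gradient of the Legendre transform, `A` its
Hessian and `T` its third derivative. At every interior point the coefficients of the linearized
operator are given by vectors `ξ` and a drift `b`. -/
structure DualSol (ι : Type*) [Fintype ι] (U Ω : Set H) (G : H → H) (A : H → H →L[ℝ] H)
    (T : H → H →L[ℝ] H →L[ℝ] H) (ε m k : ℝ) : Prop where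
  hasFDeriv_G : ∀ y ∈ closure U, HasFDerivWithinAt G (A y) (closure U) y
  hasFDeriv_A : ∀ y ∈ closure U, HasFDerivWithinAt A (T y) (closure U) y
  symm_T : ∀ y ∈ closure U, ∀ a b c, ⟪T y a b, c⟫ = ⟪T y b a, c⟫
  symm_T' : ∀ y ∈ closure U, ∀ a b c, ⟪T y a b, c⟫ = ⟪b, T y a c⟫
  smooth_G : ∀ y ∈ U, ContDiffAt ℝ 2 G y
  smooth_A : ∀ y ∈ U, ContDiffAt ℝ 2 A y
  symm_A : ∀ y ∈ closure U, ∀ v w, ⟪A y v, w⟫ = ⟪v, A y w⟫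
  lower_A : ∀ y ∈ closure U, ∀ v, m * ‖v‖ ^ 2 ≤ ⟪A y v, v⟫
  maps : ∀ y ∈ U, G y ∈ Ω
  maps_frontier : ∀ y ∈ frontier U, G y ∈ frontier Ω
  pde : ∀ y ∈ U, ∃ (ξ : ι → H) (b : H), ‖b‖ ≤ ε ∧ m ≤ ∑ i, ‖ξ i‖ ^ 2 ∧ ∑ i, ‖ξ i‖ ^ 2 ≤ k ∧
    ∑ i, ‖A y (ξ i)‖ ^ 2 ≤ k ∧
    (∀ e, |∑ i, ⟪e, T y (ξ i) (ξ i)⟫ + ⟪e, A y b⟫| ≤ k * ‖e‖) ∧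
    ∀ ς, ‖ς‖ = 1 → -k * (1 + ε * ‖A y ς‖) ≤
      ∑ i, ⟪ς, fderiv ℝ (fderiv ℝ A) y (ξ i) (ξ i) ς⟫ + ⟪ς, T y b ς⟫

variable {U Ω : Set H} {h ht : H → ℝ} {ν νt : H → H} {θ θt k ε m : ℝ}
  {G : H → H} {A : H → H →L[ℝ] H} {T : H → H →L[ℝ] H →L[ℝ] H}

namespace DualSol

theorem maps_closure (D : DualSol ι U Ω G A T ε m k) (B : Barrier U h ν θ k) {y : H}
    (hy : y ∈ closure U) : G y ∈ closure Ω := by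
  rcases B.mem_or_frontier hy with h1 | h1
  · exact subset_closure (D.maps y h1)
  · exact (D.maps_frontier y h1).1

theorem continuousOn_G (D : DualSol ι U Ω G A T ε m k) : ContinuousOn G (closure U) :=
  fun y hy => (D.hasFDeriv_G y hy).continuousWithinAt

theorem continuousOn_A (D : DualSol ι U Ω G A T ε m k) : ContinuousOn A (closure U) :=
  fun y hy => (D.hasFDeriv_A y hy).continuousWithinAt

theorem hasFDerivAt_G (D : DualSol ι U Ω G A T ε m k) (B : Barrier U h ν θ k) {y : H}
    (hy : y ∈ U) : HasFDerivAt G (A y) y :=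
  (D.hasFDeriv_G y (subset_closure hy)).hasFDerivAt
    (Filter.mem_of_superset (B.isOpen.mem_nhds hy) subset_closure)

theorem hasFDerivAt_A (D : DualSol ι U Ω G A T ε m k) (B : Barrier U h ν θ k) {y : H}
    (hy : y ∈ U) : HasFDerivAt A (T y) y :=
  (D.hasFDeriv_A y (subset_closure hy)).hasFDerivAt
    (Filter.mem_of_superset (B.isOpen.mem_nhds hy) subset_closure)

theorem hasJet_G (D : DualSol ι U Ω G A T ε m k) (B : Barrier U h ν θ k) {y : H}
    (hy : y ∈ U) (v : H) : HasJet (fun t : ℝ => G (y + t • v)) (A y v) (T y v v) := by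
  have h1 := hasJet_comp_line (D.smooth_G y hy) v
  have h2 : fderiv ℝ G =ᶠ[𝓝 y] A := by
    filter_upwards [B.isOpen.mem_nhds hy] with z hz using (D.hasFDerivAt_G B hz).fderiv
  rwa [h2.fderiv_eq, h2.eq_of_nhds, (D.hasFDerivAt_A B hy).fderiv] at h1

theorem hasJet_A (D : DualSol ι U Ω G A T ε m k) (B : Barrier U h ν θ k) {y : H}
    (hy : y ∈ U) (ς v : H) : HasJet (fun t : ℝ => ⟪ς, A (y + t • v) ς⟫) ⟪ς, T y v ς⟫
      ⟪ς, fderiv ℝ (fderiv ℝ A) y v v ς⟫ := by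
  have h1 := hasJet_comp_line (D.smooth_A y hy) v
  rw [(D.hasFDerivAt_A B hy).fderiv] at h1
  exact (h1.clm (ContinuousLinearMap.apply ℝ H ς)).inner_const ς

/-- The linearized operator applied to the defining function `h` is negative. -/
theorem operator_barrier (B : Barrier U h ν θ k) (hmθ : m ≤ θ) (hm : 0 < m)
    (hε : k * ε ≤ m ^ 2 / 2) {y b : H} (hy : y ∈ U) {ξ : ι → H} (hb : ‖b‖ ≤ ε)
    (hξ : m ≤ ∑ i, ‖ξ i‖ ^ 2) :
    ∑ i, ⟪fderiv ℝ ν y (ξ i), ξ i⟫ + ⟪ν y, b⟫ ≤ -(m ^ 2 / 2) := by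
  have hk : 0 ≤ k := (norm_nonneg _).trans (B.bound_grad y (subset_closure hy))
  have h1 : ∑ i, ⟪fderiv ℝ ν y (ξ i), ξ i⟫ ≤ ∑ i, -θ * ‖ξ i‖ ^ 2 :=
    Finset.sum_le_sum fun i _ => B.concave y (ξ i)
  rw [← Finset.mul_sum] at h1
  have h2 : ⟪ν y, b⟫ ≤ k * ε := (real_inner_le_norm _ _).trans
    (mul_le_mul (B.bound_grad y (subset_closure hy)) hb (norm_nonneg _) hk)
  nlinarith

/-- Comparison of the defining function with the boundary function of the dual problem. -/
theorem le_barrier (D : DualSol ι U Ω G A T ε m k) (B : Barrier U h ν θ k)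
    (Bt : Barrier Ω ht νt θt k) (hmθ : m ≤ θ) (hm : 0 < m) (hk : 0 < k)
    (hε : k * ε ≤ m ^ 2 / 2) {s : ℝ} (hs : 0 < s) (hs' : s * (2 * k ^ 2) < m ^ 2 / 2) :
    ∀ y ∈ closure U, s * ht (G y) ≤ h y := by
  have key := B.nonpos_of_no_max (φ := fun y => s * ht (G y) - h y)
    (((continuousOn_const.mul (Bt.continuous.comp_continuousOn D.continuousOn_G))).sub
      B.continuous.continuousOn)
    (fun y hy => by
      rw [B.eq_zero_of_frontier hy, Bt.eq_zero_of_frontier (D.maps_frontier y hy)]; simp)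
    (fun y hy hmax => by
      obtain ⟨ξ, b, hb, hξ, -, hAξ, hP, -⟩ := D.pde y hy
      have hcl : G y ∈ closure Ω := subset_closure (D.maps y hy)
      have hj : ∀ v, HasJet (fun t : ℝ => s * ht (G (y + t • v)) - h (y + t • v)) _ _ :=
        fun v => (((D.hasJet_G B hy v).comp_grad Bt.hasFDerivAt Bt.differentiable).const_mul
          s).sub ((hasJet_line y v).comp_grad B.hasFDerivAt B.differentiable)
      have h1 := hmax.sum_jet_nonpos hj ξ b
      simp only [zero_smul, add_zero, inner_zero_right] at h1
      have h2 := operator_barrier B hmθ hm hε hy hb hξ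
      have h3 : -(k * k) ≤ ∑ i, ⟪fderiv ℝ νt (G y) (A y (ξ i)), A y (ξ i)⟫ := by
        have h4 : ∀ i, -(k * ‖A y (ξ i)‖ ^ 2) ≤
            ⟪fderiv ℝ νt (G y) (A y (ξ i)), A y (ξ i)⟫ := fun i => by
          have h5 := abs_real_inner_le_norm (fderiv ℝ νt (G y) (A y (ξ i))) (A y (ξ i))
          have h6 := (fderiv ℝ νt (G y)).le_of_opNorm_le (Bt.bound_hess _ hcl) (A y (ξ i))
          have h7 : ‖fderiv ℝ νt (G y) (A y (ξ i))‖ * ‖A y (ξ i)‖ ≤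
            k * ‖A y (ξ i)‖ * ‖A y (ξ i)‖ := by gcongr
          linarith [neg_abs_le ⟪fderiv ℝ νt (G y) (A y (ξ i)), A y (ξ i)⟫]
        have h5 := Finset.sum_le_sum fun i (_ : i ∈ Finset.univ) => h4 i
        rw [Finset.sum_neg_distrib, ← Finset.mul_sum] at h5
        nlinarith
      have h4 := (abs_le.1 (hP (νt (G y)))).1
      have h5 := Bt.bound_grad _ hcl
      simp only [Finset.sum_sub_distrib, ← Finset.mul_sum, Finset.sum_add_distrib] at h1
      have h6 : -(2 * k ^ 2) ≤ ∑ i, ⟪fderiv ℝ νt (G y) (A y (ξ i)), A y (ξ i)⟫ +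
          ∑ i, ⟪νt (G y), T y (ξ i) (ξ i)⟫ + ⟪νt (G y), A y b⟫ := by nlinarith
      nlinarith)
  intro y hy
  linarith [key y hy]

/-- The structure of the Hessian at a boundary point: strict obliqueness and the bound of the
second derivatives in the oblique direction. -/
theorem oblique (D : DualSol ι U Ω G A T ε m k) (B : Barrier U h ν θ k)
    (Bt : Barrier Ω ht νt θt k) (hm : 0 < m) {s : ℝ} (hs : 0 < s)
    (hcomp : ∀ y ∈ closure U, s * ht (G y) ≤ h y) {y : H} (hy : y ∈ frontier U) :
    ∃ κ : ℝ, 0 < κ ∧ κ ≤ 1 / s ∧ A y (νt (G y)) = κ • ν y ∧ m * s ≤ ⟪νt (G y), ν y⟫ := by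
  have hyc := hy.1
  have hGy := D.maps_frontier y hy
  have hd : HasFDerivWithinAt (fun z => ht (G z)) (innerSL ℝ (A y (νt (G y)))) (closure U) y := by
    have h1 := (Bt.hasFDerivAt (G y)).comp_hasFDerivWithinAt y (D.hasFDeriv_G y hyc)
    refine h1.congr_fderiv ?_
    ext v
    simp [D.symm_A y hyc]
  obtain ⟨κ, hκ0, hκ⟩ := B.exists_eq_smul hy hd
    (fun z hz => Bt.nonneg (D.maps_closure B hz)) (Bt.eq_zero_of_frontier hGy)
  have hd2 : HasFDerivWithinAt (fun z => h z - s * ht (G z))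
      (innerSL ℝ (ν y - s • A y (νt (G y)))) (closure U) y := by
    have h1 := (B.hasFDerivAt y).hasFDerivWithinAt.sub (hd.const_smul s)
    refine h1.congr_fderiv ?_
    ext v
    simp
  obtain ⟨τ, hτ0, hτ⟩ := B.exists_eq_smul hy hd2 (fun z hz => by linarith [hcomp z hz])
    (by rw [B.eq_zero_of_frontier hy, Bt.eq_zero_of_frontier hGy]; simp)
  have hνν : ⟪ν y, ν y⟫ = (1 : ℝ) := by rw [real_inner_self_eq_norm_sq, B.unit y hy]; norm_num
  have h1 : 1 - s * κ = τ := by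
    have := congrArg (fun w => ⟪ν y, w⟫) hτ
    simpa [hκ, inner_sub_right, inner_smul_right, B.unit y hy] using this
  have h2 := D.lower_A y hyc (νt (G y))
  rw [Bt.unit _ hGy, hκ, inner_smul_left, real_inner_comm] at h2
  simp only [one_pow, mul_one, conj_trivial] at h2
  have hκ1 : κ ≤ 1 / s := by rw [le_div_iff₀ hs]; linarith
  have hκpos : 0 < κ := by
    rcases hκ0.eq_or_lt with h3 | h3
    · rw [← h3] at h2; linarith
    · exact h3
  refine ⟨κ, hκpos, hκ1, hκ, ?_⟩
  have h3 : s * κ ≤ 1 := by linarith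
  have h4 : 0 < ⟪νt (G y), ν y⟫ := by
    by_contra! h5
    nlinarith
  nlinarith

end DualSol

end Dual

section DualEstimates

variable {H ι : Type*} [NormedAddCommGroup H] [InnerProductSpace ℝ H] [Fintype ι]

/-- Decomposition of the quadratic form at a boundary point along the oblique direction `β`. -/
theorem quadratic_le_of_oblique {A : H →L[ℝ] H} {β n ς : H} {κ s M : ℝ}
    (hsym : ∀ v w, ⟪A v, w⟫ = ⟪v, A w⟫) (hβ : ‖β‖ = 1) (hn : ‖n‖ = 1) (hAβ : A β = κ • n)
    (hκ : 0 < κ) (hκs : κ ≤ 1 / s) (hob : 0 < ⟪β, n⟫)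
    (hM : ∀ w, ‖w‖ = 1 → ⟪w, n⟫ = 0 → ⟪w, A w⟫ ≤ M) (hς : ‖ς‖ = 1) :
    ⟪ς, A ς⟫ ≤ M * (1 - 2 * (⟪ς, n⟫ / ⟪β, n⟫) * ⟪ς, β⟫ + (⟪ς, n⟫ / ⟪β, n⟫) ^ 2) +
      (⟪ς, n⟫ / ⟪β, n⟫) ^ 2 / s := by
  have hM' : ∀ w, ⟪w, n⟫ = 0 → ⟪w, A w⟫ ≤ M * ‖w‖ ^ 2 := by
    intro w hw
    rcases eq_or_ne w 0 with rfl | h0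
    · simp
    · have hp : 0 < ‖w‖ := norm_pos_iff.2 h0
      have h1 := hM (‖w‖⁻¹ • w) (by rw [norm_smul, norm_inv, norm_norm]; field_simp)
        (by rw [inner_smul_left, hw]; simp)
      rw [map_smul, inner_smul_left, inner_smul_right] at h1
      simp only [conj_trivial] at h1
      have h2 : ‖w‖⁻¹ * (‖w‖⁻¹ * ⟪w, A w⟫) * ‖w‖ ^ 2 = ⟪w, A w⟫ := by field_simp
      rw [← h2]
      gcongr
  set r := ⟪ς, n⟫ / ⟪β, n⟫ with hr
  have hrn : r * ⟪β, n⟫ = ⟪ς, n⟫ := by rw [hr]; field_simp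
  set w := ς - r • β with hw
  have hwn : ⟪w, n⟫ = 0 := by rw [hw, inner_sub_left, inner_smul_left]; simp [hrn]
  have hwA : ⟪w, A β⟫ = 0 := by rw [hAβ, inner_smul_right, hwn, mul_zero]
  have hς' : ς = w + r • β := by rw [hw]; simp
  have h1 : ⟪ς, A ς⟫ = ⟪w, A w⟫ + r ^ 2 * (κ * ⟪β, n⟫) := by
    have h2 : ⟪β, A w⟫ = 0 := by rw [← hsym, real_inner_comm, hwA]
    have h3 : ⟪β, A β⟫ = κ * ⟪β, n⟫ := by rw [hAβ, inner_smul_right]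
    rw [hς']
    simp only [map_add, map_smul, inner_add_left, inner_add_right, inner_smul_left,
      inner_smul_right, hwA, h2, h3, conj_trivial]
    ring
  have h2 : ‖w‖ ^ 2 = 1 - 2 * r * ⟪ς, β⟫ + r ^ 2 := by
    rw [hw, norm_sub_sq_real, inner_smul_right, norm_smul, hς, hβ]
    simp
    ring
  have h3 : κ * ⟪β, n⟫ ≤ 1 / s := by
    have : ⟪β, n⟫ ≤ 1 := by simpa [hβ, hn] using real_inner_le_norm β n
    nlinarith
  have h4 := hM' w hwn
  rw [h2] at h4
  have h5 : r ^ 2 * (κ * ⟪β, n⟫) ≤ r ^ 2 * (1 / s) := by gcongr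
  rw [h1]
  calc _ ≤ _ := add_le_add h4 h5
    _ = _ := by ring

/-- A one-sided second derivative test. -/
theorem eventually_lt_of_second_deriv {φ φ' : ℝ → ℝ} {b : ℝ}
    (h1 : ∀ᶠ t in 𝓝[>] (0 : ℝ), HasDerivAt φ (φ' t) t)
    (h0 : ContinuousWithinAt φ (Ioi 0) 0) (h2 : φ' 0 = 0)
    (h3 : HasDerivWithinAt φ' b (Ioi 0) 0) (hb : 0 < b) :
    ∀ᶠ t in 𝓝[>] (0 : ℝ), φ 0 < φ t := by
  have h4 : ∀ᶠ t in 𝓝[>] (0 : ℝ), 0 < φ' t := by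
    have h5 := (hasDerivWithinAt_iff_tendsto_slope' self_notMem_Ioi).1 h3
    filter_upwards [h5.eventually (lt_mem_nhds hb), self_mem_nhdsWithin] with t h6 h7
    have h7 : 0 < t := h7
    simp only [slope, vsub_eq_sub, sub_zero, h2, smul_eq_mul] at h6
    exact pos_of_mul_pos_right h6 (by positivity)
  obtain ⟨τ, hτ, hsub⟩ := mem_nhdsGT_iff_exists_Ioo_subset.1 (h1.and h4)
  have hτ : 0 < τ := hτ
  filter_upwards [Ioo_mem_nhdsGT hτ] with t ht
  have hd : ∀ x ∈ Ioo 0 t, HasDerivAt φ (φ' x) x := fun x hx =>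
    (hsub ⟨hx.1, hx.2.trans ht.2⟩).1
  have hc : ContinuousOn φ (Icc 0 t) := by
    intro x hx
    rcases hx.1.eq_or_lt with h5 | h5
    · rw [← h5]
      have : ContinuousWithinAt φ (Ici 0) 0 := by
        rw [← Ioi_insert]
        exact h0.insert
      exact this.mono Icc_subset_Ici_self
    · exact (hsub ⟨h5, hx.2.trans_lt ht.2⟩).1.continuousAt.continuousWithinAt
  obtain ⟨x, hx, hxe⟩ := exists_hasDerivAt_eq_slope φ φ' ht.1 hc hd
  have h6 := (hsub ⟨hx.1, hx.2.trans ht.2⟩).2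
  rw [hxe] at h6
  have h7 := (div_pos_iff_of_pos_right (by linarith [ht.1])).1 h6
  linarith

variable {U Ω : Set H} {h ht : H → ℝ} {ν νt : H → H} {θ θt k ε m : ℝ}
  {G : H → H} {A : H → H →L[ℝ] H} {T : H → H →L[ℝ] H →L[ℝ] H}

namespace DualSol

theorem le_of_boundary (D : DualSol ι U Ω G A T ε m k) (B : Barrier U h ν θ k)
    (hmθ : m ≤ θ) (hm : 0 < m) (hk : 0 < k) (hε0 : 0 ≤ ε)
    (hε : k * ε ≤ m ^ 2 / 2) {L Mb : ℝ} (hMb : ∀ y ∈ closure U, ∀ v, ‖A y v‖ ≤ Mb * ‖v‖)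
    {ς : H} (hς : ‖ς‖ = 1) (hL : ∀ y ∈ frontier U, ⟪ς, A y ς⟫ ≤ L) :
    ∀ y ∈ closure U, ⟪ς, A y ς⟫ ≤ L + 4 * k ^ 2 * (1 + ε * Mb) / m ^ 2 := by
  intro z hz
  have hMb0 : 0 ≤ Mb := by
    have := hMb z hz ς
    rw [hς, mul_one] at this
    exact (norm_nonneg _).trans this
  set Q := 4 * k * (1 + ε * Mb) / m ^ 2 with hQ
  have hQ0 : 0 ≤ Q := by positivity
  have key := B.nonpos_of_no_max (φ := fun y => ⟪ς, A y ς⟫ - L - Q * h y)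
    (((continuousOn_const.inner (D.continuousOn_A.clm_apply continuousOn_const)).sub
      continuousOn_const).sub (continuousOn_const.mul B.continuous.continuousOn))
    (fun y hy => by
      rw [B.eq_zero_of_frontier hy]
      linarith [hL y hy])
    (fun y hy hmax => by
      obtain ⟨ξ, b, hb, hξ, -, -, -, hP⟩ := D.pde y hy
      have hj : ∀ v, HasJet (fun t : ℝ => ⟪ς, A (y + t • v) ς⟫ - L - Q * h (y + t • v)) _ _ :=
        fun v => ((D.hasJet_A B hy ς v).sub (hasJet_const L)).sub
          (((hasJet_line y v).comp_grad B.hasFDerivAt B.differentiable).const_mul Q)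
      have h1 := hmax.sum_jet_nonpos hj ξ b
      simp only [zero_smul, add_zero, inner_zero_right, sub_zero, Finset.sum_sub_distrib,
        ← Finset.mul_sum] at h1
      have h2 := operator_barrier B hmθ hm hε hy hb hξ
      have h3 := hP ς hς
      have h4 := hMb y (subset_closure hy) ς
      rw [hς, mul_one] at h4
      have h5 : Q * (m ^ 2 / 2) = 2 * (k * (1 + ε * Mb)) := by rw [hQ]; field_simp; ring
      have h6 : k * (1 + ε * ‖A y ς‖) ≤ k * (1 + ε * Mb) := by gcongr
      have h7 : 0 < k * (1 + ε * Mb) := by positivity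
      nlinarith)
  have h1 := key z hz
  have h2 : Q * h z ≤ Q * k := by
    gcongr
    exact (le_abs_self _).trans (B.bound z hz)
  have h3 : Q * k = 4 * k ^ 2 * (1 + ε * Mb) / m ^ 2 := by rw [hQ]; ring
  linarith

/-- The full Hessian is controlled by its values on the boundary. -/
theorem norm_le_of_boundary [FiniteDimensional ℝ H] (D : DualSol ι U Ω G A T ε m k)
    (B : Barrier U h ν θ k)
    (hmθ : m ≤ θ) (hm : 0 < m) (hk : 0 < k) (hε0 : 0 ≤ ε)
    (hε : k * ε ≤ m ^ 2 / 2) (hε' : ε * (8 * k ^ 2) ≤ m ^ 2) {L : ℝ}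
    (hL : ∀ y ∈ frontier U, ∀ ς, ‖ς‖ = 1 → ⟪ς, A y ς⟫ ≤ L) :
    ∀ y ∈ closure U, ∀ v, ‖A y v‖ ≤ (2 * L + 8 * k ^ 2 / m ^ 2) * ‖v‖ := by
  intro z hz v
  rcases eq_or_ne v 0 with rfl | hv
  · simp
  have hcomp : IsCompact (closure U ×ˢ Metric.sphere (0 : H) 1) :=
    B.isCompact.prod (isCompact_sphere 0 1)
  have hcont : ContinuousOn (fun p : H × H => ⟪p.2, A p.1 p.2⟫)
      (closure U ×ˢ Metric.sphere (0 : H) 1) :=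
    continuousOn_snd.inner ((D.continuousOn_A.comp continuousOn_fst fun p hp => hp.1).clm_apply
      continuousOn_snd)
  obtain ⟨⟨y1, ς1⟩, ⟨hy1, hς1⟩, hmax⟩ := hcomp.exists_isMaxOn
    ⟨(z, ‖v‖⁻¹ • v), hz, by simp [norm_smul, hv]⟩ hcont
  have hς1 : ‖ς1‖ = 1 := by simpa using hς1
  set Mb := ⟪ς1, A y1 ς1⟫ with hMbdef
  have hMb0 : 0 ≤ Mb := by
    have := D.lower_A y1 hy1 ς1
    rw [real_inner_comm, hς1] at this
    rw [hMbdef]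
    linarith
  have hMb : ∀ y ∈ closure U, ∀ v, ‖A y v‖ ≤ Mb * ‖v‖ := by
    intro y hy
    refine norm_apply_le_of_quadratic hMb0 (D.symm_A y hy)
      (fun v => le_trans (by positivity) (D.lower_A y hy v)) fun v => ?_
    rcases eq_or_ne v 0 with rfl | hv
    · simp
    · have hp : 0 < ‖v‖ := norm_pos_iff.2 hv
      have h1 : ⟪‖v‖⁻¹ • v, A y (‖v‖⁻¹ • v)⟫ ≤ Mb := by
        simpa using hmax (show (y, ‖v‖⁻¹ • v) ∈ closure U ×ˢ Metric.sphere (0 : H) 1 from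
          ⟨hy, by simp [norm_smul, hv]⟩)
      rw [map_smul, inner_smul_left, inner_smul_right] at h1
      simp only [conj_trivial] at h1
      have h2 : ‖v‖⁻¹ * (‖v‖⁻¹ * ⟪v, A y v⟫) * ‖v‖ ^ 2 = ⟪v, A y v⟫ := by field_simp
      rw [real_inner_comm, ← h2]
      gcongr
  have h1 := D.le_of_boundary B hmθ hm hk hε0 hε hMb hς1 (fun y hy => hL y hy ς1 hς1) y1 hy1
  have h2 : 4 * k ^ 2 * (1 + ε * Mb) / m ^ 2 ≤ 4 * k ^ 2 / m ^ 2 + Mb / 2 := by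
    rw [div_add' _ _ _ (by positivity), div_le_div_iff_of_pos_right (by positivity)]
    nlinarith
  have h3 : Mb ≤ 2 * L + 8 * k ^ 2 / m ^ 2 := by
    have : 8 * k ^ 2 / m ^ 2 = 2 * (4 * k ^ 2 / m ^ 2) := by ring
    rw [← hMbdef] at h1
    linarith
  exact (hMb z hz v).trans (by gcongr)

end DualSol

end DualEstimates

section TangentialEstimate

variable {H ι : Type*} [NormedAddCommGroup H] [InnerProductSpace ℝ H] [Fintype ι]

theorem abs_div_sub_div_le {a a' b b' ω x z : ℝ} (hω : 0 < ω) (hb : ω ≤ b) (hb' : ω ≤ b')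
    (ha' : |a'| ≤ 1) (hx : |a - a'| ≤ x) (hz : |b - b'| ≤ z) :
    |a / b - a' / b'| ≤ x / ω + z / ω ^ 2 := by
  have hb0 : 0 < b := hω.trans_le hb
  have hb0' : 0 < b' := hω.trans_le hb'
  have h1 : a / b - a' / b' = (a - a') / b - a' * (b - b') / (b * b') := by field_simp; ring
  rw [h1]
  refine (abs_sub _ _).trans (add_le_add ?_ ?_)
  · rw [abs_div, abs_of_pos hb0]
    gcongr
    exact (abs_nonneg _).trans hx
  · rw [abs_div, abs_mul, abs_of_pos (mul_pos hb0 hb0')]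
    have hz0 : 0 ≤ z := (abs_nonneg _).trans hz
    have h2 : |a'| * |b - b'| ≤ z := by nlinarith [abs_nonneg a', abs_nonneg (b - b')]
    have h3 : ω ^ 2 ≤ b * b' := by nlinarith
    gcongr

variable {U Ω : Set H} {h ht : H → ℝ} {ν νt : H → H} {θ θt k ε m : ℝ}
  {G : H → H} {A : H → H →L[ℝ] H} {T : H → H →L[ℝ] H →L[ℝ] H}

namespace DualSol

set_option maxHeartbeats 800000 in
/-- Boundary inequality for the auxiliary function. -/
theorem quadratic_boundary_le (D : DualSol ι U Ω G A T ε m k) (B : Barrier U h ν θ k)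
    (Bt : Barrier Ω ht νt θt k) (hm : 0 < m) (hk : 0 < k) {s M : ℝ} (hs : 0 < s) (hM0 : 0 ≤ M)
    (hcomp : ∀ y ∈ closure U, s * ht (G y) ≤ h y)
    (hM : ∀ y ∈ frontier U, ∀ w, ‖w‖ = 1 → ⟪w, ν y⟫ = 0 → ⟪w, A y w⟫ ≤ M)
    {y₀ ς : H} (hy₀ : y₀ ∈ frontier U) (hς : ‖ς‖ = 1) (hςν : ⟪ς, ν y₀⟫ = 0)
    {y : H} (hy : y ∈ frontier U) :
    ⟪ς, A y ς⟫ ≤ M - 2 * M * (⟪ς, νt (G y₀)⟫ / ⟪νt (G y₀), ν y₀⟫) * ⟪ς, ν y⟫ +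
      (k ^ 2 + 2 * (k / (m * s) + k / (m * s) ^ 2) ^ 2 + k ^ 2 / (m * s) ^ 2 +
        k ^ 2 / (m * s) ^ 2 / s) * (1 + M) * (‖y - y₀‖ ^ 2 + ‖G y - G y₀‖ ^ 2) := by
  obtain ⟨κ, hκ, hκs, hAβ, hob⟩ := D.oblique B Bt hm hs hcomp hy
  obtain ⟨-, -, -, -, hob₀⟩ := D.oblique B Bt hm hs hcomp hy₀
  have hω : 0 < m * s := mul_pos hm hs
  set ω := m * s
  have hβ := Bt.unit _ (D.maps_frontier y hy)
  have hβ₀ := Bt.unit _ (D.maps_frontier y₀ hy₀)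
  have hn := B.unit y hy
  have hn₀ := B.unit y₀ hy₀
  have hq := quadratic_le_of_oblique (D.symm_A y hy.1) hβ hn hAβ hκ hκs (hω.trans_le hob)
    (hM y hy) hς
  have hd := B.lipschitz y hy.1 y₀ hy₀.1
  have hd' := Bt.lipschitz _ (D.maps_frontier y hy).1 _ (D.maps_frontier y₀ hy₀).1
  set β := νt (G y)
  set β₀ := νt (G y₀)
  set d := ‖y - y₀‖
  set d' := ‖G y - G y₀‖
  have hd0 : 0 ≤ d := norm_nonneg _
  have hd0' : 0 ≤ d' := norm_nonneg _
  set a := ⟪ς, ν y⟫ with ha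
  have ha2 : a ^ 2 ≤ k ^ 2 * d ^ 2 := by
    have h1 : |a| ≤ k * d := by
      have : a = ⟪ς, ν y - ν y₀⟫ := by rw [inner_sub_right, hςν, sub_zero]
      rw [this]
      refine (abs_real_inner_le_norm _ _).trans ?_
      rwa [hς, one_mul]
    rw [← sq_abs, ← mul_pow]
    gcongr
  set g := ⟪ς, β⟫ / ⟪β, ν y⟫ with hg
  set g₀ := ⟪ς, β₀⟫ / ⟪β₀, ν y₀⟫ with hg₀
  have hgg : |g - g₀| ≤ k * d' / ω + (k * d' + k * d) / ω ^ 2 := by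
    refine abs_div_sub_div_le hω hob hob₀ ?_ ?_ ?_
    · simpa [hς, hβ₀] using abs_real_inner_le_norm ς β₀
    · rw [← inner_sub_right]
      refine (abs_real_inner_le_norm _ _).trans ?_
      rwa [hς, one_mul]
    · have : ⟪β, ν y⟫ - ⟪β₀, ν y₀⟫ = ⟪β - β₀, ν y⟫ + ⟪β₀, ν y - ν y₀⟫ := by
        rw [inner_sub_left, inner_sub_right]; ring
      rw [this]
      refine (abs_add_le _ _).trans (add_le_add ?_ ?_)
      · refine (abs_real_inner_le_norm _ _).trans ?_
        rwa [hn, mul_one]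
      · refine (abs_real_inner_le_norm _ _).trans ?_
        rwa [hβ₀, one_mul]
  have hgg2 : (g - g₀) ^ 2 ≤ 2 * (k / ω + k / ω ^ 2) ^ 2 * (d ^ 2 + d' ^ 2) := by
    have h1 : |g - g₀| ≤ (k / ω + k / ω ^ 2) * (d + d') := by
      refine hgg.trans ?_
      have : (k / ω + k / ω ^ 2) * (d + d') =
        k * d' / ω + (k * d' + k * d) / ω ^ 2 + k / ω * d := by ring
      rw [this]
      have : 0 ≤ k / ω * d := by positivity
      linarith
    have h2 : (g - g₀) ^ 2 ≤ ((k / ω + k / ω ^ 2) * (d + d')) ^ 2 := by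
      rw [← sq_abs]
      gcongr
    have h3 : (d + d') ^ 2 ≤ 2 * (d ^ 2 + d' ^ 2) := by nlinarith [sq_nonneg (d - d')]
    calc (g - g₀) ^ 2 ≤ (k / ω + k / ω ^ 2) ^ 2 * (d + d') ^ 2 := by rw [← mul_pow]; exact h2
      _ ≤ (k / ω + k / ω ^ 2) ^ 2 * (2 * (d ^ 2 + d' ^ 2)) := by gcongr
      _ = _ := by ring
  have hr : (a / ⟪β, ν y⟫) ^ 2 ≤ k ^ 2 / ω ^ 2 * d ^ 2 := by
    rw [div_pow, div_mul_eq_mul_div]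
    gcongr
  have hrg : a / ⟪β, ν y⟫ * ⟪ς, β⟫ = a * g := by rw [hg]; ring
  set P := d ^ 2 + d' ^ 2 with hP
  have hP0 : d ^ 2 ≤ P := le_add_of_nonneg_right (sq_nonneg d')
  have hP00 : 0 ≤ P := by positivity
  have e1 : -(2 * M * (a * (g - g₀))) ≤ M * (k ^ 2 * P + 2 * (k / ω + k / ω ^ 2) ^ 2 * P) := by
    have h1 : -(2 * (a * (g - g₀))) ≤ a ^ 2 + (g - g₀) ^ 2 := by
      linarith [sq_nonneg (a + (g - g₀)), add_sq a (g - g₀)]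
    have h2 : k ^ 2 * d ^ 2 ≤ k ^ 2 * P := by gcongr
    calc -(2 * M * (a * (g - g₀))) = M * -(2 * (a * (g - g₀))) := by ring
      _ ≤ _ := mul_le_mul_of_nonneg_left (by linarith) hM0
  have hr' : (a / ⟪β, ν y⟫) ^ 2 ≤ k ^ 2 / ω ^ 2 * P := hr.trans (by gcongr)
  have e2 : M * (a / ⟪β, ν y⟫) ^ 2 ≤ M * (k ^ 2 / ω ^ 2 * P) := by gcongr
  have e3 : (a / ⟪β, ν y⟫) ^ 2 / s ≤ k ^ 2 / ω ^ 2 / s * P := by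
    rw [div_mul_eq_mul_div (k ^ 2 / ω ^ 2)]
    gcongr
  have hlast : (k ^ 2 + 2 * (k / ω + k / ω ^ 2) ^ 2 + k ^ 2 / ω ^ 2 + k ^ 2 / ω ^ 2 / s) *
      (1 + M) * P = M * (k ^ 2 * P + 2 * (k / ω + k / ω ^ 2) ^ 2 * P) + M * (k ^ 2 / ω ^ 2 * P)
      + k ^ 2 / ω ^ 2 / s * P + (k ^ 2 * P + 2 * (k / ω + k / ω ^ 2) ^ 2 * P +
        k ^ 2 / ω ^ 2 * P + M * (k ^ 2 / ω ^ 2 / s * P)) := by ring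
  have hpos : 0 ≤ k ^ 2 * P + 2 * (k / ω + k / ω ^ 2) ^ 2 * P +
        k ^ 2 / ω ^ 2 * P + M * (k ^ 2 / ω ^ 2 / s * P) := by positivity
  rw [hlast]
  have : M * (1 - 2 * (a / ⟪β, ν y⟫) * ⟪ς, β⟫ + (a / ⟪β, ν y⟫) ^ 2) =
      M - 2 * M * g₀ * a - 2 * M * (a * (g - g₀)) + M * (a / ⟪β, ν y⟫) ^ 2 := by
    linear_combination (-2 * M) * hrg
  linarith

set_option maxHeartbeats 800000 in
/-- Bound of the oblique derivative of the tangential second derivative at a boundary maximum. -/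
theorem oblique_deriv_le (D : DualSol ι U Ω G A T ε m k) (B : Barrier U h ν θ k)
    (Bt : Barrier Ω ht νt θt k) (hmθ : m ≤ θ) (hm : 0 < m) (hk : 1 ≤ k) (hε0 : 0 ≤ ε)
    (hε1 : ε ≤ 1) (hε : k * ε ≤ m ^ 2 / 2) {s M Mb Λ Q g₀ : ℝ} (hM0 : 0 ≤ M) (hΛ : 0 ≤ Λ)
    (hMb : ∀ y ∈ closure U, ∀ v, ‖A y v‖ ≤ Mb * ‖v‖)
    {y₀ ς : H} (hy₀ : y₀ ∈ frontier U) (hς : ‖ς‖ = 1) (hςν : ⟪ς, ν y₀⟫ = 0)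
    (hM : ⟪ς, A y₀ ς⟫ = M) (hs : 0 < s) (hg₀ : |g₀| ≤ 1 / (m * s))
    (hbd : ∀ y ∈ frontier U, ⟪ς, A y ς⟫ ≤ M - 2 * M * g₀ * ⟪ς, ν y⟫ +
      Λ * (1 + M) * (‖y - y₀‖ ^ 2 + ‖G y - G y₀‖ ^ 2))
    (hQ0 : 0 ≤ Q)
    (hQ : k * (1 + Mb) + 2 * M / (m * s) * (2 * k ^ 2) + Λ * (1 + M) * (12 * k ^ 2) <
      Q * (m ^ 2 / 2)) {β : H} (hβ : ‖β‖ = 1) (hβν : 0 < ⟪ν y₀, β⟫) :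
    ⟪ς, T y₀ β ς⟫ ≤ Q + 2 * M / (m * s) * k := by
  have hω : 0 < m * s := mul_pos hm hs
  have hMg : |2 * M * g₀| ≤ 2 * M / (m * s) := by
    rw [abs_mul, abs_of_nonneg (by positivity : 0 ≤ 2 * M)]
    calc 2 * M * |g₀| ≤ 2 * M * (1 / (m * s)) := by gcongr
      _ = _ := by ring
  have hGc := D.maps_closure B hy₀.1
  have key := B.nonpos_of_no_max (φ := fun y => ⟪ς, A y ς⟫ + 2 * M * g₀ * ⟪ς, ν y⟫ - M -
      Λ * (1 + M) * (‖y - y₀‖ ^ 2 + ‖G y - G y₀‖ ^ 2) - Q * h y) ?_ ?_ ?_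
  · have hz := D.hasFDeriv_A y₀ hy₀.1
    have hd1 : HasFDerivWithinAt (fun y => ⟪ς, A y ς⟫)
        ((innerSL ℝ ς).comp ((ContinuousLinearMap.apply ℝ H ς).comp (T y₀))) (closure U) y₀ :=
      (innerSL ℝ ς).hasFDerivAt.comp_hasFDerivWithinAt y₀
        ((ContinuousLinearMap.apply ℝ H ς).hasFDerivAt.comp_hasFDerivWithinAt y₀ hz)
    have hd2 : HasFDerivWithinAt (fun y => ⟪ς, ν y⟫)
        ((innerSL ℝ ς).comp (fderiv ℝ ν y₀)) (closure U) y₀ :=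
      (innerSL ℝ ς).hasFDerivAt.comp_hasFDerivWithinAt y₀
        (B.differentiable y₀).hasFDerivAt.hasFDerivWithinAt
    have hd3 : HasFDerivWithinAt (fun y => ‖y - y₀‖ ^ 2) _ (closure U) y₀ :=
      ((hasFDerivAt_id y₀).sub_const y₀).norm_sq.hasFDerivWithinAt
    have hd4 : HasFDerivWithinAt (fun y => ‖G y - G y₀‖ ^ 2) _ (closure U) y₀ :=
      ((D.hasFDeriv_G y₀ hy₀.1).sub_const (G y₀)).norm_sq
    have hd := ((((hd1.add (hd2.const_smul (2 * M * g₀))).sub_const M).sub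
      ((hd3.add hd4).const_smul (Λ * (1 + M)))).sub
      ((B.hasFDerivAt y₀).hasFDerivWithinAt.const_smul Q)).neg
    have h1 := B.fderivWithin_nonneg hy₀ hβν hd
      (fun z hz => by
        have := key z hz
        simp only [Pi.neg_apply, Pi.sub_apply, Pi.add_apply, Pi.smul_apply, smul_eq_mul]
        linarith)
      (by simp [hM, hςν, B.eq_zero_of_frontier hy₀])
    simp only [_root_.neg_apply, _root_.sub_apply, _root_.add_apply, _root_.smul_apply,
      ContinuousLinearMap.comp_apply, innerSL_apply_apply, smul_eq_mul, id, sub_self,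
      ContinuousLinearMap.apply_apply, map_zero, _root_.zero_apply,
      mul_zero, smul_zero, add_zero] at h1
    have h2 : |2 * M * g₀ * ⟪ς, fderiv ℝ ν y₀ β⟫| ≤ 2 * M / (m * s) * k := by
      rw [abs_mul]
      refine mul_le_mul hMg ?_ (abs_nonneg _) (by positivity)
      refine (abs_real_inner_le_norm _ _).trans ?_
      rw [hς, one_mul]
      simpa [hβ] using (fderiv ℝ ν y₀).le_of_opNorm_le (B.bound_hess _ hy₀.1) β
    have h3 : Q * ⟪ν y₀, β⟫ ≤ Q := by
      have : ⟪ν y₀, β⟫ ≤ 1 := by simpa [hβ, B.unit y₀ hy₀] using real_inner_le_norm (ν y₀) β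
      nlinarith
    have := neg_abs_le (2 * M * g₀ * ⟪ς, fderiv ℝ ν y₀ β⟫)
    linarith
  · have := D.continuousOn_A
    have := D.continuousOn_G
    have h1 := B.differentiable.continuous
    have h2 := B.continuous
    fun_prop
  · intro y hy
    rw [B.eq_zero_of_frontier hy]
    linarith [hbd y hy]
  · intro y hy hmax
    have hyc := subset_closure hy
    have hGyc := subset_closure (D.maps y hy)
    obtain ⟨ξ, b, hb, hξ, hξk, hAξ, hP1, hP2⟩ := D.pde y hy
    have hj : ∀ v, HasJet (fun t : ℝ => ⟪ς, A (y + t • v) ς⟫ +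
        2 * M * g₀ * ⟪ς, ν (y + t • v)⟫ - M -
        Λ * (1 + M) * (‖(y + t • v) - y₀‖ ^ 2 + ‖G (y + t • v) - G y₀‖ ^ 2) -
        Q * h (y + t • v)) _ _ := fun v =>
      ((((D.hasJet_A B hy ς v).add
        (((hasJet_comp_line B.smooth.contDiffAt v).inner_const ς).const_mul (2 * M * g₀))).sub
        (hasJet_const M)).sub
        ((((hasJet_line y v).sub (hasJet_const y₀)).norm_sq.add
          ((D.hasJet_G B hy v).sub (hasJet_const (G y₀))).norm_sq).const_mul (Λ * (1 + M)))).sub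
        (((hasJet_line y v).comp_grad B.hasFDerivAt B.differentiable).const_mul Q)
    have h1 := hmax.sum_jet_nonpos hj ξ b
    simp only [zero_smul, add_zero, inner_zero_right, sub_zero, Finset.sum_sub_distrib,
      ← Finset.mul_sum, Finset.sum_add_distrib] at h1
    have h2 := operator_barrier B hmθ hm hε hy hb hξ
    have h3 := hP2 ς hς
    have h4 := hMb y hyc ς
    rw [hς, mul_one] at h4
    have hMb0 : 0 ≤ Mb := (norm_nonneg _).trans h4
    have h5 : k * (1 + ε * ‖A y ς‖) ≤ k * (1 + Mb) := by
      have : ε * ‖A y ς‖ ≤ 1 * Mb := by gcongr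
      nlinarith
    have hX1 : |∑ i, ⟪ς, fderiv ℝ (fderiv ℝ ν) y (ξ i) (ξ i)⟫| ≤ k * k := by
      calc _ ≤ ∑ i, |⟪ς, fderiv ℝ (fderiv ℝ ν) y (ξ i) (ξ i)⟫| := Finset.abs_sum_le_sum_abs _ _
        _ ≤ ∑ i, k * ‖ξ i‖ ^ 2 := by
          refine Finset.sum_le_sum fun i _ => (abs_real_inner_le_norm _ _).trans ?_
          rw [hς, one_mul, pow_two, ← mul_assoc]
          refine (ContinuousLinearMap.le_opNorm₂ _ _ _).trans ?_
          gcongr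
          exact B.bound_third y hyc
        _ ≤ k * k := by rw [← Finset.mul_sum]; gcongr
    have hX2 : |⟪ς, fderiv ℝ ν y b⟫| ≤ k := by
      refine (abs_real_inner_le_norm _ _).trans ?_
      rw [hς, one_mul]
      refine ((fderiv ℝ ν y).le_of_opNorm_le (B.bound_hess _ hyc) b).trans ?_
      nlinarith [norm_nonneg b]
    have hX : |2 * M * g₀ * (∑ i, ⟪ς, fderiv ℝ (fderiv ℝ ν) y (ξ i) (ξ i)⟫ +
        ⟪ς, fderiv ℝ ν y b⟫)| ≤ 2 * M / (m * s) * (2 * k ^ 2) := by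
      rw [abs_mul]
      refine mul_le_mul hMg ?_ (abs_nonneg _) (by positivity)
      refine (abs_add_le _ _).trans ?_
      nlinarith
    have hY1 : ⟪y - y₀, b⟫ ≤ 2 * k := by
      refine (real_inner_le_norm _ _).trans ?_
      have : ‖y - y₀‖ ≤ 2 * k := (norm_sub_le _ _).trans
        (by linarith [B.bound_norm y hyc, B.bound_norm y₀ hy₀.1])
      nlinarith [norm_nonneg b, norm_nonneg (y - y₀)]
    have hY2 := (abs_le.1 (hP1 (G y - G y₀))).2
    have hY3 : k * ‖G y - G y₀‖ ≤ 2 * k ^ 2 := by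
      have : ‖G y - G y₀‖ ≤ 2 * k := (norm_sub_le _ _).trans
        (by linarith [Bt.bound_norm _ hGyc, Bt.bound_norm _ hGc])
      nlinarith
    have hY : Λ * (1 + M) * (2 * ∑ i, ‖ξ i‖ ^ 2 + 2 * (∑ i, ‖A y (ξ i)‖ ^ 2 +
        ∑ i, ⟪G y - G y₀, T y (ξ i) (ξ i)⟫) + (2 * ⟪y - y₀, b⟫ + 2 * ⟪G y - G y₀, A y b⟫)) ≤
        Λ * (1 + M) * (12 * k ^ 2) := by
      refine mul_le_mul_of_nonneg_left ?_ (by positivity)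
      have hkk : k ≤ k ^ 2 := le_self_pow₀ hk two_ne_zero
      linarith
    have hh : Q * (∑ i, ⟪fderiv ℝ ν y (ξ i), ξ i⟫ + ⟪ν y, b⟫) ≤ Q * (-(m ^ 2 / 2)) := by
      gcongr
    have := neg_abs_le (2 * M * g₀ * (∑ i, ⟪ς, fderiv ℝ (fderiv ℝ ν) y (ξ i) (ξ i)⟫ +
        ⟪ς, fderiv ℝ ν y b⟫))
    linarith

end DualSol

end TangentialEstimate

section BoundaryCurve

variable {H ι : Type*} [NormedAddCommGroup H] [InnerProductSpace ℝ H] [Fintype ι]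
  {U Ω : Set H} {h ht : H → ℝ} {ν νt : H → H} {θ θt k ε m : ℝ}
  {G : H → H} {A : H → H →L[ℝ] H} {T : H → H →L[ℝ] H →L[ℝ] H}

theorem HasJet.eventually_lt {φ : ℝ → ℝ} {b : ℝ} (hφ : HasJet φ 0 b) (hb : 0 < b) :
    ∀ᶠ t in 𝓝[>] (0 : ℝ), φ 0 < φ t := by
  have h0 := hφ.hasDerivAt.continuousAt
  obtain ⟨φ', h1, h2, h3⟩ := hφ
  exact eventually_lt_of_second_deriv (h1.filter_mono nhdsWithin_le_nhds) h0.continuousWithinAt h2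
    h3.hasDerivWithinAt hb

theorem hasDerivAt_parabola (y ς w : H) (t : ℝ) :
    HasDerivAt (fun t : ℝ => y + t • ς + t ^ 2 • w) (ς + (2 * t) • w) t := by
  refine HasDerivAt.add ?_ ?_
  · simpa using ((hasDerivAt_id t).smul_const ς).const_add y
  · simpa using (hasDerivAt_pow 2 t).smul_const w

theorem hasDerivAt_parabola_deriv (ς w : H) (t : ℝ) :
    HasDerivAt (fun t : ℝ => ς + (2 * t) • w) ((2 : ℝ) • w) t := by
  simpa using (((hasDerivAt_id t).const_mul 2).smul_const w).const_add ς

theorem Barrier.eventually_parabola_mem (B : Barrier U h ν θ k) (hk : 0 < k) {y ς : H}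
    (hy : y ∈ frontier U) (hς : ‖ς‖ = 1) (hςν : ⟪ς, ν y⟫ = 0) :
    ∀ᶠ t in 𝓝[>] (0 : ℝ), y + t • ς + t ^ 2 • (k • ν y) ∈ U := by
  have hj : HasJet (fun t : ℝ => y + t • ς + t ^ 2 • (k • ν y)) ς ((2 : ℝ) • (k • ν y)) :=
    ⟨fun t => ς + (2 * t) • (k • ν y),
      Filter.Eventually.of_forall fun t => hasDerivAt_parabola y ς (k • ν y) t, by simp,
      hasDerivAt_parabola_deriv ς (k • ν y) 0⟩
  have h1 := hj.comp_grad B.hasFDerivAt B.differentiable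
  simp only [zero_smul, add_zero, ne_eq, OfNat.ofNat_ne_zero, not_false_eq_true, zero_pow,
    inner_smul_right, real_inner_self_eq_norm_sq, B.unit y hy] at h1
  rw [real_inner_comm, hςν] at h1
  have h2 : -k ≤ ⟪fderiv ℝ ν y ς, ς⟫ := by
    have h3 := neg_abs_le ⟪fderiv ℝ ν y ς, ς⟫
    have h4 := abs_real_inner_le_norm (fderiv ℝ ν y ς) ς
    have h5 := (fderiv ℝ ν y).le_of_opNorm_le (B.bound_hess y hy.1) ς
    rw [hς, mul_one] at h4 h5
    linarith
  filter_upwards [h1.eventually_lt (by linarith)] with t ht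
  rw [B.mem_iff]
  simpa [B.eq_zero_of_frontier hy] using ht

/-- Differentiating the boundary condition twice along a boundary curve. -/
theorem DualSol.second_order_boundary (D : DualSol ι U Ω G A T ε m k) (B : Barrier U h ν θ k)
    (Bt : Barrier Ω ht νt θt k) (hk : 0 < k) {y ς : H}
    (hy : y ∈ frontier U) (hς : ‖ς‖ = 1) (hςν : ⟪ς, ν y⟫ = 0)
    (htan : ⟪νt (G y), A y ς⟫ = 0) :
    0 ≤ ⟪fderiv ℝ νt (G y) (A y ς), A y ς⟫ + ⟪νt (G y), T y ς ς⟫ +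
      2 * k * ⟪νt (G y), A y (ν y)⟫ := by
  by_contra! hneg
  set p : ℝ → H := fun t => y + t • ς + t ^ 2 • (k • ν y) with hp
  set p' : ℝ → H := fun t => ς + (2 * t) • (k • ν y) with hp'
  have hp0 : p 0 = y := by simp [hp]
  have hp0' : p' 0 = ς := by simp [hp']
  have hd : ∀ t, HasDerivAt p (p' t) t := hasDerivAt_parabola y ς (k • ν y)
  have hd' := hasDerivAt_parabola_deriv ς (k • ν y) 0
  have hmem : ∀ᶠ t in 𝓝[>] (0 : ℝ), p t ∈ U := B.eventually_parabola_mem hk hy hς hςν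
  obtain ⟨τ, hτ, hsub⟩ := mem_nhdsGT_iff_exists_Ioo_subset.1 hmem
  have hS : Ioo 0 τ ∈ 𝓝[>] (0 : ℝ) := Ioo_mem_nhdsGT hτ
  have hmaps : MapsTo p (Ioo 0 τ) (closure U) := fun t ht => subset_closure (hsub ht)
  have hyc : p 0 ∈ closure U := by rw [hp0]; exact hy.1
  have hG0 : HasDerivWithinAt (fun t => G (p t)) (A y ς) (Ioo 0 τ) 0 := by
    have := (D.hasFDeriv_G _ hyc).comp_hasDerivWithinAt 0 (hd 0).hasDerivWithinAt hmaps
    rwa [hp0, hp0'] at this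
  have hA0 : HasDerivWithinAt (fun t => A (p t)) (T y ς) (Ioo 0 τ) 0 := by
    have := (D.hasFDeriv_A _ hyc).comp_hasDerivWithinAt 0 (hd 0).hasDerivWithinAt hmaps
    rwa [hp0, hp0'] at this
  have hAp : HasDerivWithinAt (fun t => A (p t) (p' t)) (T y ς ς + A y ((2 : ℝ) • (k • ν y)))
      (Ioo 0 τ) 0 := by
    have := hA0.clm_apply hd'.hasDerivWithinAt
    rwa [hp0, mul_zero, zero_smul, add_zero] at this
  have hν0 : HasDerivWithinAt (fun t => νt (G (p t))) (fderiv ℝ νt (G y) (A y ς)) (Ioo 0 τ) 0 := by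
    have h1 := (Bt.differentiable (G (p 0))).hasFDerivAt.comp_hasDerivWithinAt 0 hG0
    rwa [hp0] at h1
  have hφ' := ((hν0.inner ℝ hAp).mono_of_mem_nhdsWithin hS).neg
  have h1 := eventually_lt_of_second_deriv (φ := fun t => -ht (G (p t))) ?_ ?_ ?_ hφ' ?_
  · obtain ⟨t, h2, h3⟩ := (h1.and hmem).exists
    have h4 := (Bt.mem_iff _).1 (D.maps _ h3)
    rw [hp0, Bt.eq_zero_of_frontier (D.maps_frontier y hy)] at h2
    linarith
  · filter_upwards [hmem] with t ht
    have h2 : HasDerivAt (fun t => G (p t)) (A (p t) (p' t)) t :=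
      (D.hasFDerivAt_G B ht).comp_hasDerivAt t (hd t)
    exact ((Bt.hasFDerivAt (G (p t))).comp_hasDerivAt t h2).neg
  · exact (Bt.continuous.continuousAt.comp_continuousWithinAt (f := fun t => G (p t))
      (hG0.mono_of_mem_nhdsWithin hS).continuousWithinAt).neg
  · simp [hp0, hp0', htan]
  · simp only [hp0, hp0', inner_add_right, map_smul, inner_smul_right]
    linarith

end BoundaryCurve

section TangentialBound

variable {H : Type*} [NormedAddCommGroup H] [InnerProductSpace ℝ H] [FiniteDimensional ℝ H]
  {U Ω : Set H} {h ht : H → ℝ} {ν νt : H → H} {θ θt k m : ℝ}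

theorem abs_inner_div_le {a : ℝ} {ω b : ℝ} (hω : 0 < ω) (ha : |a| ≤ 1) (hb : ω ≤ b) :
    |a / b| ≤ 1 / ω := by
  rw [abs_div, abs_of_pos (hω.trans_le hb)]
  gcongr

set_option maxHeartbeats 1000000 in
/-- The tangential second derivatives of solutions of the dual problem are bounded on the boundary
in terms of the constants `m` and `k`. -/
theorem exists_tangential_bound (ι : Type*) [Fintype ι] (B : Barrier U h ν θ k)
    (Bt : Barrier Ω ht νt θt k) (hm : 0 < m) (hmθ : m ≤ θ) (hmθt : m ≤ θt) (hk : 1 ≤ k) :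
    ∃ ε C : ℝ, 0 < ε ∧ 0 < C ∧ ∀ (G : H → H) (A : H → H →L[ℝ] H) (T : H → H →L[ℝ] H →L[ℝ] H),
      DualSol ι U Ω G A T ε m k → ∀ y ∈ frontier U, ∀ ς, ‖ς‖ = 1 → ⟪ς, ν y⟫ = 0 →
        ⟪ς, A y ς⟫ ≤ C := by
  have hk0 : 0 < k := one_pos.trans_le hk
  obtain ⟨s, hs, hs2⟩ : ∃ s : ℝ, 0 < s ∧ s * (2 * k ^ 2) < m ^ 2 / 2 := by
    refine ⟨m ^ 2 / (8 * k ^ 2), by positivity, ?_⟩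
    have : m ^ 2 / (8 * k ^ 2) * (2 * k ^ 2) = m ^ 2 / 4 := by field_simp; norm_num
    rw [this]
    have : 0 < m ^ 2 := by positivity
    linarith
  obtain ⟨ω, hω, hωms⟩ : ∃ ω, 0 < ω ∧ m * s = ω := ⟨m * s, mul_pos hm hs, rfl⟩
  obtain ⟨ε, hε0, hε1, hε, hε'⟩ : ∃ ε : ℝ, 0 < ε ∧ ε ≤ 1 ∧ k * ε ≤ m ^ 2 / 2 ∧
      ε * (8 * k ^ 2) ≤ m ^ 2 := by
    have h1 : min 1 (m ^ 2 / (8 * k ^ 2)) * (8 * k ^ 2) ≤ m ^ 2 := by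
      calc _ ≤ m ^ 2 / (8 * k ^ 2) * (8 * k ^ 2) := by gcongr; exact min_le_right _ _
        _ = m ^ 2 := by field_simp
    have h2 : 0 < min 1 (m ^ 2 / (8 * k ^ 2)) := by positivity
    refine ⟨_, h2, min_le_left _ _, ?_, h1⟩
    nlinarith
  obtain ⟨c₃, hc₃, hc₃0⟩ : ∃ c, (1 + 1 / ω) ^ 2 + 1 / (s * ω ^ 2) = c ∧ 0 < c :=
    ⟨_, rfl, by positivity⟩
  obtain ⟨c₄, hc₄, hc₄0⟩ : ∃ c, 2 * c₃ + 8 * k ^ 2 / m ^ 2 = c ∧ 0 < c := ⟨_, rfl, by positivity⟩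
  obtain ⟨Λ, hΛ, hΛ0⟩ : ∃ Λ, (k ^ 2 + 2 * (k / ω + k / ω ^ 2) ^ 2 + k ^ 2 / ω ^ 2 +
        k ^ 2 / ω ^ 2 / s) = Λ ∧ 0 < Λ := ⟨_, rfl, by positivity⟩
  obtain ⟨q, hq, hq0⟩ : ∃ q, (k + k * c₄ + 4 * k ^ 2 / ω + 12 * k ^ 2 * Λ + 1) =
      q * (m ^ 2 / 2) ∧ 0 < q :=
    ⟨(k + k * c₄ + 4 * k ^ 2 / ω + 12 * k ^ 2 * Λ + 1) / (m ^ 2 / 2), by field_simp,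
      by positivity⟩
  obtain ⟨C₁, hC₁, hC₁0⟩ : ∃ C, q + 2 * k / ω + 2 * k / s = C ∧ 0 < C := ⟨_, rfl, by positivity⟩
  refine ⟨ε, 1 + 2 * C₁ / m, hε0, by positivity, fun G A T D y hy ς hς hςν => ?_⟩
  have hcomp : ∀ y ∈ closure U, s * ht (G y) ≤ h y := D.le_barrier B Bt hmθ hm hk0 hε hs hs2
  have hS : IsCompact (closure U ×ˢ Metric.sphere (0 : H) 1 ∩
      {p : H × H | h p.1 = 0 ∧ ⟪p.2, ν p.1⟫ = 0}) := by
    refine (B.isCompact.prod (isCompact_sphere 0 1)).inter_right ?_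
    have h1 := B.continuous
    have h2 := B.differentiable.continuous
    exact (isClosed_eq (by fun_prop) continuous_const).inter
      (isClosed_eq (by fun_prop) continuous_const)
  have hcont : ContinuousOn (fun p : H × H => ⟪p.2, A p.1 p.2⟫)
      (closure U ×ˢ Metric.sphere (0 : H) 1 ∩ {p : H × H | h p.1 = 0 ∧ ⟪p.2, ν p.1⟫ = 0}) := by
    have h1 : ContinuousOn (fun p : H × H => A p.1)
        (closure U ×ˢ Metric.sphere (0 : H) 1 ∩ {p : H × H | h p.1 = 0 ∧ ⟪p.2, ν p.1⟫ = 0}) :=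
      D.continuousOn_A.comp continuousOn_fst fun p hp => hp.1.1
    exact continuousOn_snd.inner (h1.clm_apply continuousOn_snd)
  have hfr : ∀ z ∈ closure U, h z = 0 → z ∈ frontier U := fun z hz hz0 =>
    (B.mem_or_frontier hz).resolve_left fun h1 => ((B.mem_iff z).1 h1).ne' hz0
  obtain ⟨⟨y₀, ς₀⟩, ⟨⟨hy₀c, hς₀⟩, hy₀, hςν₀⟩, hmax⟩ :=
    hS.exists_isMaxOn ⟨(y, ς), ⟨hy.1, by simpa using hς⟩, B.eq_zero_of_frontier hy, hςν⟩ hcont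
  dsimp only at hy₀c hy₀ hςν₀ hς₀
  have hy₀ := hfr _ hy₀c hy₀
  simp only [mem_sphere_iff_norm, sub_zero] at hς₀
  obtain ⟨M, hM⟩ : ∃ M, ⟪ς₀, A y₀ ς₀⟫ = M := ⟨_, rfl⟩
  have hMle : ∀ y ∈ frontier U, ∀ w, ‖w‖ = 1 → ⟪w, ν y⟫ = 0 → ⟪w, A y w⟫ ≤ M := by
    intro z hz w hw hwν
    rw [← hM]
    exact hmax (a := (z, w)) ⟨⟨hz.1, by simpa using hw⟩, B.eq_zero_of_frontier hz, hwν⟩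
  refine (hMle y hy ς hς hςν).trans ?_
  have hM0 : 0 ≤ M := by
    have h1 := D.lower_A y₀ hy₀c ς₀
    rw [hς₀, real_inner_comm, hM] at h1
    linarith
  have hL : ∀ y ∈ frontier U, ∀ ς, ‖ς‖ = 1 → ⟪ς, A y ς⟫ ≤ c₃ * (1 + M) := by
    intro z hz w hw
    obtain ⟨κ, hκ, hκs, hAβ, hob⟩ := D.oblique B Bt hm hs hcomp hz
    have hβ := Bt.unit _ (D.maps_frontier z hz)
    rw [hωms] at hob
    have h1 := quadratic_le_of_oblique (D.symm_A z hz.1) hβ (B.unit z hz) hAβ hκ hκs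
      (hω.trans_le hob) (hMle z hz) hw
    have hr : |⟪w, ν z⟫ / ⟪νt (G z), ν z⟫| ≤ 1 / ω :=
      abs_inner_div_le hω (by simpa [hw, B.unit z hz] using abs_real_inner_le_norm w (ν z)) hob
    have hwβ : |⟪w, νt (G z)⟫| ≤ 1 := by simpa [hw, hβ] using abs_real_inner_le_norm w (νt (G z))
    generalize ⟪w, ν z⟫ / ⟪νt (G z), ν z⟫ = r at h1 hr
    have h2 : r ^ 2 ≤ (1 / ω) ^ 2 := by rw [← sq_abs]; gcongr
    have h3 : -(r * ⟪w, νt (G z)⟫) ≤ 1 / ω := by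
      refine (neg_le_abs _).trans ?_
      rw [abs_mul, ← mul_one (1 / ω)]
      gcongr
    have h4 : M * (1 - 2 * r * ⟪w, νt (G z)⟫ + r ^ 2) ≤ M * (1 + 1 / ω) ^ 2 := by
      gcongr
      linarith
    have h5 : r ^ 2 / s ≤ 1 / (s * ω ^ 2) := by
      calc r ^ 2 / s ≤ (1 / ω) ^ 2 / s := by gcongr
        _ = _ := by field_simp
    have h6 : c₃ * (1 + M) = M * (1 + 1 / ω) ^ 2 + 1 / (s * ω ^ 2) +
        ((1 + 1 / ω) ^ 2 + M * (1 / (s * ω ^ 2))) := by rw [← hc₃]; ring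
    have h7 : 0 ≤ (1 + 1 / ω) ^ 2 + M * (1 / (s * ω ^ 2)) := by positivity
    linarith
  have hMb : ∀ y ∈ closure U, ∀ v, ‖A y v‖ ≤ c₄ * (1 + M) * ‖v‖ := by
    intro z hz v
    refine (D.norm_le_of_boundary B hmθ hm hk0 hε0.le hε hε' hL z hz v).trans ?_
    gcongr
    have : 0 ≤ 8 * k ^ 2 / m ^ 2 * M := by positivity
    rw [← hc₄]
    linarith
  obtain ⟨κ, hκ, hκs, hAβ, hob⟩ := D.oblique B Bt hm hs hcomp hy₀
  rw [hωms] at hob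
  have hβ := Bt.unit _ (D.maps_frontier y₀ hy₀)
  have hbd := fun z hz => D.quadratic_boundary_le B Bt hm hk0 hs hM0 hcomp hMle hy₀ hς₀ hςν₀
    (y := z) hz
  rw [hωms, hΛ] at hbd
  have hT := D.oblique_deriv_le B Bt hmθ hm hk hε0.le hε1 hε hM0 hΛ0.le hMb hy₀ hς₀ hςν₀ hM hs
    (g₀ := ⟪ς₀, νt (G y₀)⟫ / ⟪νt (G y₀), ν y₀⟫) (Q := q * (1 + M))
    (by
      rw [hωms]
      exact abs_inner_div_le hω
        (by simpa [hς₀, hβ] using abs_real_inner_le_norm ς₀ (νt (G y₀))) hob)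
    hbd (by positivity)
    (by
      rw [hωms]
      have h1 : q * (1 + M) * (m ^ 2 / 2) =
          (k + k * c₄ + 4 * k ^ 2 / ω + 12 * k ^ 2 * Λ + 1) * (1 + M) := by rw [hq]; ring
      have h2 : 0 < k * M + 4 * k ^ 2 / ω + 1 + M := by positivity
      rw [h1]
      have h3 : 2 * M / ω * (2 * k ^ 2) = 4 * k ^ 2 / ω * M := by ring
      linarith)
    hβ (by rw [real_inner_comm]; exact hω.trans_le hob)
  rw [hωms] at hT
  have htan : ⟪νt (G y₀), A y₀ ς₀⟫ = 0 := by
    rw [← D.symm_A y₀ hy₀c, hAβ, inner_smul_left, real_inner_comm, hςν₀, mul_zero]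
  have h2nd := D.second_order_boundary B Bt hk0 hy₀ hς₀ hςν₀ htan
  have hκ' : ⟪νt (G y₀), A y₀ (ν y₀)⟫ = κ := by
    rw [← D.symm_A y₀ hy₀c, hAβ, inner_smul_left, real_inner_self_eq_norm_sq, B.unit y₀ hy₀]
    simp
  have hTT : ⟪νt (G y₀), T y₀ ς₀ ς₀⟫ = ⟪ς₀, T y₀ (νt (G y₀)) ς₀⟫ := by
    rw [← D.symm_T' y₀ hy₀c, D.symm_T y₀ hy₀c, real_inner_comm]
  rw [hκ', hTT] at h2nd
  have hconc := Bt.concave (G y₀) (A y₀ ς₀)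
  have hMn : M ≤ ‖A y₀ ς₀‖ := by
    rw [← hM]
    simpa [hς₀] using real_inner_le_norm ς₀ (A y₀ ς₀)
  have hquad : m * M ^ 2 ≤ C₁ * (1 + M) := by
    have h1 : m * M ^ 2 ≤ θt * ‖A y₀ ς₀‖ ^ 2 :=
      mul_le_mul hmθt (by gcongr) (by positivity) (hm.le.trans hmθt)
    have h2 : 2 * k * κ ≤ 2 * k / s := by
      calc 2 * k * κ ≤ 2 * k * (1 / s) := by gcongr
        _ = _ := by ring
    have h3 : C₁ * (1 + M) = q * (1 + M) + 2 * M / ω * k + 2 * k / s +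
        (2 * k / ω + 2 * k / s * M) := by rw [← hC₁]; ring
    have h4 : 0 ≤ 2 * k / ω + 2 * k / s * M := by positivity
    linarith
  by_contra! hlt
  have h1 : 1 < M := by
    have : 0 < 2 * C₁ / m := by positivity
    linarith
  have h2 : 2 * C₁ < m * M := by
    rw [mul_comm m, ← div_lt_iff₀ hm]
    linarith
  nlinarith

end TangentialBound

section Gradients

variable {H : Type*} [NormedAddCommGroup H] [InnerProductSpace ℝ H] [CompleteSpace H]

/-- The inverse Riesz map as a continuous linear map. -/
def rieszInv : (H →L[ℝ] ℝ) →L[ℝ] H :=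
  LinearMap.mkContinuous
    { toFun := fun ℓ => (InnerProductSpace.toDual ℝ H).symm ℓ
      map_add' := fun a b => map_add _ a b
      map_smul' := fun r a => by simp } 1 fun ℓ => by simp

theorem inner_rieszInv (ℓ : H →L[ℝ] ℝ) (v : H) : ⟪rieszInv ℓ, v⟫ = ℓ v :=
  InnerProductSpace.toDual_symm_apply

theorem gradient_eq_rieszInv (f : H → ℝ) : gradient f = fun x => rieszInv (fderiv ℝ f x) := rfl

theorem inner_gradient (f : H → ℝ) (x v : H) : ⟪gradient f x, v⟫ = fderiv ℝ f x v :=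
  inner_rieszInv _ v

theorem innerSL_gradient (f : H → ℝ) (x : H) : innerSL ℝ (gradient f x) = fderiv ℝ f x := by
  ext v
  exact inner_gradient f x v

theorem norm_gradient (f : H → ℝ) (x : H) : ‖gradient f x‖ = ‖fderiv ℝ f x‖ :=
  (InnerProductSpace.toDual ℝ H).symm.norm_map _

end Gradients

section Hessians

variable {n : ℕ}

theorem Euc.sum_single (v : Euc n) : ∑ i, v i • EuclideanSpace.single i (1 : ℝ) = v := by
  ext j
  simp [Pi.single_apply]

theorem clm_apply_eq_dotProduct (L : Euc n →L[ℝ] Euc n →L[ℝ] ℝ) (v w : Euc n) :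
    L v w = (fun i => v i) ⬝ᵥ (Matrix.of fun i j => L (EuclideanSpace.single i 1)
      (EuclideanSpace.single j 1)).mulVec (fun i => w i) := by
  conv_lhs => rw [← Euc.sum_single v, ← Euc.sum_single w]
  simp only [map_sum, map_smul, _root_.sum_apply, _root_.smul_apply, smul_eq_mul, dotProduct,
    Matrix.mulVec, Finset.mul_sum, Matrix.of_apply]
  rw [Finset.sum_comm]
  exact Finset.sum_congr rfl fun i _ => Finset.sum_congr rfl fun j _ => by ring

theorem hess_eq_of (u : Euc n → ℝ) (x : Euc n) : Hess u x = Matrix.of fun i j =>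
    fderiv ℝ (fderiv ℝ u) x (EuclideanSpace.single i 1) (EuclideanSpace.single j 1) := by
  ext i j
  simp [Hess, iteratedFDeriv_two_apply]

theorem dotProduct_hess (u : Euc n → ℝ) (x v w : Euc n) :
    (fun i => v i) ⬝ᵥ (Hess u x).mulVec (fun i => w i) = fderiv ℝ (fderiv ℝ u) x v w := by
  rw [hess_eq_of, ← clm_apply_eq_dotProduct]

theorem Euc.dotProduct_self (v : Euc n) : (fun i => v i) ⬝ᵥ (fun i => v i) = ‖v‖ ^ 2 := by
  rw [EuclideanSpace.norm_sq_eq]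
  simp [dotProduct, pow_two]

theorem hess_le_iff {u : Euc n → ℝ} {x : Euc n} {c : ℝ}
    (h : MatLE (Hess u x) (c • (1 : Matrix (Fin n) (Fin n) ℝ))) (v : Euc n) :
    fderiv ℝ (fderiv ℝ u) x v v ≤ c * ‖v‖ ^ 2 := by
  have h1 := h.dotProduct_mulVec_nonneg (fun i => v i)
  simp only [star_trivial, Matrix.sub_mulVec, dotProduct_sub, dotProduct_hess, Matrix.smul_mulVec,
    Matrix.one_mulVec, dotProduct_smul, Euc.dotProduct_self, smul_eq_mul] at h1
  linarith

/-- A uniformly concave defining function of a bounded domain is a barrier. -/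
theorem exists_barrier {U : Set (Euc n)} {h : Euc n → ℝ} {θ : ℝ}
    (hb : Bornology.IsBounded U) (hh : ContDiff ℝ (⊤ : ℕ∞) h) (hU : U = {y | 0 < h y})
    (hunit : ∀ y ∈ frontier U, ‖gradient h y‖ = 1)
    (hconc : ∀ y, MatLE (Hess h y) ((-θ) • (1 : Matrix (Fin n) (Fin n) ℝ))) :
    ∃ k₀ : ℝ, ∀ k, k₀ ≤ k → Barrier U h (gradient h) θ k := by
  have hd : Differentiable ℝ h := hh.differentiable (by simp)
  have h2 : ContDiff ℝ 2 (fderiv ℝ h) := hh.fderiv_right (WithTop.coe_le_coe.2 le_top)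
  have hν : ContDiff ℝ 2 (gradient h) := rieszInv.contDiff.comp h2
  have hdν : Differentiable ℝ (gradient h) := hν.differentiable (by norm_num)
  obtain ⟨R, hR⟩ := hb.closure.subset_closedBall (0 : Euc n)
  have hK : IsCompact (Metric.closedBall (0 : Euc n) R) := isCompact_closedBall 0 R
  have hν1 : ContDiff ℝ 1 (fderiv ℝ (gradient h)) := hν.fderiv_right (by norm_num)
  have hν0 : Continuous (fderiv ℝ (fderiv ℝ (gradient h))) := hν1.continuous_fderiv (by norm_num)
  obtain ⟨k₁, h₁⟩ := hK.exists_bound_of_continuousOn hd.continuous.continuousOn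
  obtain ⟨k₂, h₂⟩ := hK.exists_bound_of_continuousOn hν.continuous.continuousOn
  obtain ⟨k₃, h₃⟩ := hK.exists_bound_of_continuousOn hν1.continuous.continuousOn
  obtain ⟨k₄, h₄⟩ := hK.exists_bound_of_continuousOn
    (f := fderiv ℝ (fderiv ℝ (gradient h))) hν0.continuousOn
  refine ⟨max R (max k₁ (max k₂ (max k₃ k₄))), fun k hk => ?_⟩
  simp only [max_le_iff] at hk
  obtain ⟨hk0, hk1, hk2, hk3, hk4⟩ := hk
  refine ⟨?_, ?_, ?_, ?_, hν, ?_, hunit, ?_, ?_, ?_, ?_, ?_, ?_⟩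
  · rw [hU]; exact isOpen_lt continuous_const hd.continuous
  · exact hK.of_isClosed_subset isClosed_closure hR
  · intro y; rw [hU]; rfl
  · intro y
    rw [innerSL_gradient]
    exact (hd y).hasFDerivAt
  · intro y v
    have h5 : fderiv ℝ (gradient h) y = rieszInv.comp (fderiv ℝ (fderiv ℝ h) y) := by
      rw [gradient_eq_rieszInv]
      exact (rieszInv.hasFDerivAt.comp y
        (h2.differentiable (by norm_num) y).hasFDerivAt).fderiv
    rw [h5, ContinuousLinearMap.comp_apply, inner_rieszInv]
    exact hess_le_iff (hconc y) v
  · intro y hy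
    simpa using (mem_closedBall_zero_iff.1 (hR hy)).trans hk0
  · intro y hy
    exact (h₁ y (hR hy)).trans hk1
  · intro y hy
    exact (h₂ y (hR hy)).trans hk2
  · intro y hy
    exact (h₃ y (hR hy)).trans hk3
  · intro y hy
    exact (h₄ y (hR hy)).trans hk4
  · intro y hy z hz
    refine (Convex.norm_image_sub_le_of_norm_fderiv_le (fun x _ => hdν x) h₃
      (convex_closedBall 0 R) (hR hz) (hR hy)).trans ?_
    gcongr

end Hessians

section Convexity

variable {H : Type*} [NormedAddCommGroup H] [InnerProductSpace ℝ H]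
  {U : Set H} {h : H → ℝ} {ν : H → H} {θ k : ℝ}

theorem Barrier.convex (B : Barrier U h ν θ k) (hθ : 0 ≤ θ) : Convex ℝ U := by
  intro x hx y hy a b ha hb hab
  rw [B.mem_iff] at *
  have hline : ∀ t : ℝ, HasDerivAt (fun t : ℝ => x + t • (y - x)) (y - x) t := fun t => by
    simpa using ((hasDerivAt_id t).smul_const (y - x)).const_add x
  have h1 : ∀ t : ℝ, HasDerivAt (fun t : ℝ => h (x + t • (y - x)))
      ⟪ν (x + t • (y - x)), y - x⟫ t := fun t =>
    (B.hasFDerivAt _).comp_hasDerivAt t (hline t)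
  have h2 : ∀ t : ℝ, HasDerivAt (fun t : ℝ => ⟪ν (x + t • (y - x)), y - x⟫)
      ⟪fderiv ℝ ν (x + t • (y - x)) (y - x), y - x⟫ t := fun t => by
    have h3 := (B.differentiable (x + t • (y - x))).hasFDerivAt.comp_hasDerivAt t (hline t)
    simpa using h3.inner ℝ (hasDerivAt_const t (y - x))
  have hderiv : deriv (fun t : ℝ => h (x + t • (y - x))) =
      fun t => ⟪ν (x + t • (y - x)), y - x⟫ := funext fun t => (h1 t).deriv
  have hc : ConcaveOn ℝ univ (fun t : ℝ => h (x + t • (y - x))) := by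
    refine concaveOn_univ_of_deriv2_nonpos (fun t => (h1 t).differentiableAt) ?_ fun t => ?_
    · rw [hderiv]
      exact fun t => (h2 t).differentiableAt
    · simp only [Function.iterate_succ, Function.iterate_zero, Function.id_comp,
        Function.comp_apply]
      rw [hderiv, (h2 t).deriv]
      have := B.concave (x + t • (y - x)) (y - x)
      nlinarith [sq_nonneg ‖y - x‖]
  have h3 := hc.2 (mem_univ 0) (mem_univ 1) ha hb hab
  simp only [zero_smul, add_zero, one_smul, add_sub_cancel, smul_eq_mul, mul_zero, mul_one,
    zero_add] at h3
  have h4 : x + b • (y - x) = a • x + b • y := by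
    rw [← eq_sub_iff_add_eq] at hab
    rw [hab]
    module
  rw [h4] at h3
  refine lt_of_lt_of_le ?_ h3
  rcases ha.eq_or_lt with rfl | ha'
  · rw [zero_add] at hab
    simpa [hab] using hy
  · exact add_pos_of_pos_of_nonneg (mul_pos ha' hx) (mul_nonneg hb hy.le)

theorem Barrier.uniqueDiffOn (B : Barrier U h ν θ k) (hθ : 0 ≤ θ) (hne : U.Nonempty) :
    UniqueDiffOn ℝ (closure U) := by
  refine uniqueDiffOn_convex (B.convex hθ).closure (hne.mono ?_)
  exact B.isOpen.subset_interior_iff.2 subset_closure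

end Convexity

section Legendre

variable {n : ℕ}

/-- A smooth uniformly convex function `u` on the closure of `Ω` with Legendre transform `ut` on
the closure of `U = ∇u(Ω)`. -/
structure LegendrePair (Ω U : Set (Euc n)) (u ut : Euc n → ℝ) : Prop where
  pos : 0 < n
  isOpen : IsOpen Ω
  isOpen_dual : IsOpen U
  isCompact : IsCompact (closure Ω)
  uniqueDiff : UniqueDiffOn ℝ (closure U)
  smooth : ContDiffOn ℝ (⊤ : ℕ∞) u (closure Ω)
  smooth_dual : ContDiffOn ℝ (⊤ : ℕ∞) ut (closure U)
  posDef : ∀ x ∈ closure Ω, (Hess u x).PosDef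
  image : gradient u '' Ω = U
  gradient_dual : ∀ x ∈ closure Ω, gradient ut (gradient u x) = x
  hess_dual : ∀ x ∈ closure Ω, Hess ut (gradient u x) = (Hess u x)⁻¹

theorem posDef_of_smul_one_le {M : Matrix (Fin n) (Fin n) ℝ} {δ : ℝ} (hδ : 0 < δ)
    (hM : MatLE (δ • (1 : Matrix (Fin n) (Fin n) ℝ)) M) : M.PosDef := by
  have h1 : M = δ • (1 : Matrix (Fin n) (Fin n) ℝ) + (M - δ • 1) := by abel
  rw [h1]
  exact (Matrix.PosDef.one.smul hδ).add_posSemidef hM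

theorem LegendrePair.of_isSmoothSol {Ω U : Set (Euc n)} {f : Euc n × Euc n → ℝ} {c : ℝ}
    {u ut : Euc n → ℝ} (hn : 0 < n) (hΩ : IsOpen Ω) (hU : IsOpen U)
    (hΩc : IsCompact (closure Ω)) (hud : UniqueDiffOn ℝ (closure U))
    (hu : IsSmoothSol Ω U f c u) (hut : IsLegendre Ω U u ut) : LegendrePair Ω U u ut where
  pos := hn
  isOpen := hΩ
  isOpen_dual := hU
  isCompact := hΩc
  uniqueDiff := hud
  smooth := hu.1
  smooth_dual := hut.1
  posDef := fun x hx => by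
    obtain ⟨δ, hδ, h⟩ := hu.2.1
    exact posDef_of_smul_one_le hδ (h x hx)
  image := hu.2.2.2.2
  gradient_dual := hut.2.2.1
  hess_dual := hut.2.2.2

theorem differentiableAt_fderiv_of_posDef (hn : 0 < n) {u : Euc n → ℝ} {x : Euc n}
    (h : (Hess u x).PosDef) : DifferentiableAt ℝ (fderiv ℝ u) x := by
  by_contra hnd
  have h1 : Hess u x = 0 := by
    rw [hess_eq_of, fderiv_zero_of_not_differentiableAt hnd]
    ext i j
    simp
  have : Nonempty (Fin n) := ⟨⟨0, hn⟩⟩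
  have h2 := h.det_pos
  rw [h1, Matrix.det_zero] at h2
  exact lt_irrefl _ h2

theorem hasFDerivAt_gradient {u : Euc n → ℝ} {x : Euc n} (h : DifferentiableAt ℝ (fderiv ℝ u) x) :
    HasFDerivAt (gradient u) (rieszInv.comp (fderiv ℝ (fderiv ℝ u) x)) x :=
  rieszInv.hasFDerivAt.comp x h.hasFDerivAt

namespace LegendrePair

variable {Ω U : Set (Euc n)} {u ut : Euc n → ℝ}

theorem differentiableAt_gradient (P : LegendrePair Ω U u ut) {x : Euc n} (hx : x ∈ closure Ω) :
    DifferentiableAt ℝ (gradient u) x :=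
  (hasFDerivAt_gradient (differentiableAt_fderiv_of_posDef P.pos (P.posDef x hx))).differentiableAt

theorem image_closure (P : LegendrePair Ω U u ut) : gradient u '' closure Ω = closure U := by
  have hc : ContinuousOn (gradient u) (closure Ω) := fun x hx =>
    (P.differentiableAt_gradient hx).continuousAt.continuousWithinAt
  refine Subset.antisymm ?_ ?_
  · rw [← P.image]
    exact hc.image_closure
  · refine closure_minimal ?_ (P.isCompact.image_of_continuousOn hc).isClosed
    rw [← P.image]
    exact image_mono subset_closure

theorem gradient_mem (P : LegendrePair Ω U u ut) {y : Euc n} (hy : y ∈ U) :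
    gradient ut y ∈ Ω := by
  rw [← P.image] at hy
  obtain ⟨x, hx, rfl⟩ := hy
  rwa [P.gradient_dual x (subset_closure hx)]

theorem gradient_mem_closure (P : LegendrePair Ω U u ut) {y : Euc n} (hy : y ∈ closure U) :
    gradient ut y ∈ closure Ω := by
  rw [← P.image_closure] at hy
  obtain ⟨x, hx, rfl⟩ := hy
  rwa [P.gradient_dual x hx]

theorem gradient_gradient (P : LegendrePair Ω U u ut) {y : Euc n} (hy : y ∈ closure U) :
    gradient u (gradient ut y) = y := by
  rw [← P.image_closure] at hy
  obtain ⟨x, hx, rfl⟩ := hy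
  rw [P.gradient_dual x hx]

theorem gradient_mem_frontier (P : LegendrePair Ω U u ut) {y : Euc n} (hy : y ∈ frontier U) :
    gradient ut y ∈ frontier Ω := by
  refine ⟨P.gradient_mem_closure hy.1, fun h => hy.2 ?_⟩
  rw [P.isOpen.interior_eq] at h
  rw [P.isOpen_dual.interior_eq, ← P.gradient_gradient hy.1, ← P.image]
  exact mem_image_of_mem _ h

theorem posDef_dual (P : LegendrePair Ω U u ut) {y : Euc n} (hy : y ∈ closure U) :
    (Hess ut y).PosDef := by
  rw [← P.image_closure] at hy
  obtain ⟨x, hx, rfl⟩ := hy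
  rw [P.hess_dual x hx]
  exact (P.posDef x hx).inv

theorem hasFDerivAt_dual (P : LegendrePair Ω U u ut) {y : Euc n} (hy : y ∈ closure U) :
    HasFDerivAt (gradient ut) (rieszInv.comp (fderiv ℝ (fderiv ℝ ut) y)) y :=
  hasFDerivAt_gradient (differentiableAt_fderiv_of_posDef P.pos (P.posDef_dual hy))

theorem inner_hess_dual (P : LegendrePair Ω U u ut) {y : Euc n} (hy : y ∈ closure U)
    (v w : Euc n) : ⟪fderiv ℝ (gradient ut) y v, w⟫ =
      (fun i => v i) ⬝ᵥ (Hess ut y).mulVec (fun i => w i) := by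
  rw [(P.hasFDerivAt_dual hy).fderiv, ContinuousLinearMap.comp_apply, inner_rieszInv,
    dotProduct_hess]

theorem symm_dual (P : LegendrePair Ω U u ut) {y : Euc n} (hy : y ∈ closure U) (v w : Euc n) :
    ⟪fderiv ℝ (gradient ut) y v, w⟫ = ⟪v, fderiv ℝ (gradient ut) y w⟫ := by
  rw [← real_inner_comm v, P.inner_hess_dual hy, P.inner_hess_dual hy, dotProduct_mulVec,
    ← Matrix.mulVec_transpose, dotProduct_comm]
  have := (P.posDef_dual hy).isHermitian
  rw [Matrix.IsHermitian, conjTranspose_eq_transpose_of_trivial] at this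
  rw [this]

theorem contDiffOn_gradient (P : LegendrePair Ω U u ut) :
    ContDiffOn ℝ (⊤ : ℕ∞) (gradient ut) (closure U) := by
  have h1 : ContDiffOn ℝ (⊤ : ℕ∞) (fderivWithin ℝ ut (closure U)) (closure U) :=
    P.smooth_dual.fderivWithin P.uniqueDiff le_rfl
  have h2 : EqOn (fderiv ℝ ut) (fderivWithin ℝ ut (closure U)) (closure U) := by
    refine EqOn.of_subset_closure (s := U) ?_ ?_ h1.continuousOn subset_closure subset_rfl
    · intro y hy
      exact (fderivWithin_of_mem_nhds
        (Filter.mem_of_superset (P.isOpen_dual.mem_nhds hy) subset_closure)).symm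
    · intro y hy
      exact (differentiableAt_fderiv_of_posDef P.pos
        (P.posDef_dual hy)).continuousAt.continuousWithinAt
  exact rieszInv.contDiff.comp_contDiffOn (h1.congr h2)

theorem fderiv_eqOn (P : LegendrePair Ω U u ut) :
    EqOn (fderiv ℝ (gradient ut)) (fderivWithin ℝ (gradient ut) (closure U)) (closure U) :=
  fun y hy => ((P.hasFDerivAt_dual hy).differentiableAt.fderivWithin (P.uniqueDiff y hy)).symm

theorem contDiffOn_fderiv (P : LegendrePair Ω U u ut) :
    ContDiffOn ℝ (⊤ : ℕ∞) (fderiv ℝ (gradient ut)) (closure U) :=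
  (P.contDiffOn_gradient.fderivWithin P.uniqueDiff le_rfl).congr P.fderiv_eqOn

theorem hasFDerivWithinAt_hess (P : LegendrePair Ω U u ut) {y : Euc n} (hy : y ∈ closure U) :
    HasFDerivWithinAt (fderiv ℝ (gradient ut))
      (fderivWithin ℝ (fderiv ℝ (gradient ut)) (closure U) y) (closure U) y :=
  (P.contDiffOn_fderiv.differentiableOn (by simp) y hy).hasFDerivWithinAt

theorem symm_third (P : LegendrePair Ω U u ut) {y : Euc n} (hy : y ∈ closure U)
    (a b : Euc n) : fderivWithin ℝ (fderiv ℝ (gradient ut)) (closure U) y a b =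
      fderivWithin ℝ (fderiv ℝ (gradient ut)) (closure U) y b a := by
  rw [fderivWithin_congr P.fderiv_eqOn (P.fderiv_eqOn hy)]
  refine (P.contDiffOn_gradient y hy).isSymmSndFDerivWithinAt ?_ P.uniqueDiff ?_ hy a b
  · rw [minSmoothness_of_isRCLikeNormedField]
    exact WithTop.coe_le_coe.2 (le_top : (2 : ℕ∞) ≤ ⊤)
  · exact closure_mono (P.isOpen_dual.subset_interior_iff.2 subset_closure) hy

theorem symm_third' (P : LegendrePair Ω U u ut) {y : Euc n} (hy : y ∈ closure U)
    (a b c : Euc n) : ⟪fderivWithin ℝ (fderiv ℝ (gradient ut)) (closure U) y a b, c⟫ =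
      ⟪b, fderivWithin ℝ (fderiv ℝ (gradient ut)) (closure U) y a c⟫ := by
  have h1 := P.hasFDerivWithinAt_hess hy
  have h2 : HasFDerivWithinAt (fun z => ⟪c, fderiv ℝ (gradient ut) z b⟫) _ (closure U) y :=
    ((innerSL ℝ c).hasFDerivAt.comp_hasFDerivWithinAt y
      ((ContinuousLinearMap.apply ℝ (Euc n) b).hasFDerivAt.comp_hasFDerivWithinAt y h1))
  have h3 : HasFDerivWithinAt (fun z => ⟪b, fderiv ℝ (gradient ut) z c⟫) _ (closure U) y :=
    ((innerSL ℝ b).hasFDerivAt.comp_hasFDerivWithinAt y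
      ((ContinuousLinearMap.apply ℝ (Euc n) c).hasFDerivAt.comp_hasFDerivWithinAt y h1))
  have h4 := h3.congr (f₁ := fun z => ⟪c, fderiv ℝ (gradient ut) z b⟫)
    (fun z hz => (real_inner_comm _ _).trans (P.symm_dual hz _ _))
    ((real_inner_comm _ _).trans (P.symm_dual hy _ _))
  have h5 := DFunLike.congr_fun ((P.uniqueDiff y hy).eq h2 h4) a
  rw [real_inner_comm]
  exact h5

theorem contDiffAt_gradient_dual (P : LegendrePair Ω U u ut) {y : Euc n} (hy : y ∈ U) :
    ContDiffAt ℝ (⊤ : ℕ∞) (gradient ut) y :=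
  P.contDiffOn_gradient.contDiffAt
    (Filter.mem_of_superset (P.isOpen_dual.mem_nhds hy) subset_closure)

theorem contDiffAt_hess_dual (P : LegendrePair Ω U u ut) {y : Euc n} (hy : y ∈ U) :
    ContDiffAt ℝ (⊤ : ℕ∞) (fderiv ℝ (gradient ut)) y :=
  P.contDiffOn_fderiv.contDiffAt
    (Filter.mem_of_superset (P.isOpen_dual.mem_nhds hy) subset_closure)

theorem hess_hess_dual (P : LegendrePair Ω U u ut) {y : Euc n} (hy : y ∈ U) (v : Euc n) :
    fderiv ℝ (gradient ut) y (fderiv ℝ (gradient u) (gradient ut y) v) = v := by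
  have hyc := subset_closure hy
  have h1 := (P.differentiableAt_gradient (P.gradient_mem_closure hyc)).hasFDerivAt
  have h2 := (P.hasFDerivAt_dual hyc).differentiableAt.hasFDerivAt
  rw [← P.gradient_gradient hyc] at h2
  have h3 := h2.comp (gradient ut y) h1
  have h4 : gradient ut ∘ gradient u =ᶠ[𝓝 (gradient ut y)] id := by
    filter_upwards [P.isOpen.mem_nhds (P.gradient_mem hy)] with x hx
      using P.gradient_dual x (subset_closure hx)
  have h5 := DFunLike.congr_fun (h3.unique ((hasFDerivAt_id _).congr_of_eventuallyEq h4)) v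
  rw [P.gradient_gradient hyc] at h5
  exact h5

end LegendrePair

end Legendre

section MinkowskiOperator

variable {n : ℕ}

/-- Vectors `σ_i(p)` with `∑ σ_i ⊗ σ_i = (1/v) (I + p ⊗ p / v²)`, where `v = √(1 - |p|²)`. -/
def minkFrame : Option (Fin n) → Euc n → Euc n
  | some i, p => (1 - ‖p‖ ^ 2) ^ (-(1 / 4) : ℝ) • EuclideanSpace.single i 1
  | none, p => (1 - ‖p‖ ^ 2) ^ (-(3 / 4) : ℝ) • p

theorem one_sub_norm_sq_pos {p : Euc n} (hp : ‖p‖ < 1) : 0 < 1 - ‖p‖ ^ 2 := by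
  nlinarith [norm_nonneg p]

theorem contDiffAt_minkFrame {p : Euc n} (hp : ‖p‖ < 1) (i : Option (Fin n)) :
    ContDiffAt ℝ (⊤ : ℕ∞) (minkFrame i) p := by
  have h1 : ContDiffAt ℝ (⊤ : ℕ∞) (fun q : Euc n => 1 - ‖q‖ ^ 2) p :=
    contDiffAt_const.sub (contDiff_norm_sq ℝ).contDiffAt
  have h2 := (one_sub_norm_sq_pos hp).ne'
  cases i with
  | none => exact (h1.rpow_const_of_ne h2).smul contDiffAt_id
  | some i => exact (h1.rpow_const_of_ne h2).smul contDiffAt_const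

theorem exists_bound_minkFrame {N : Set (Euc n)} (hN : IsCompact N)
    (hb : N ⊆ Metric.ball (0 : Euc n) 1) : ∃ κ, ∀ p ∈ N, ∀ i, ‖minkFrame i p‖ ≤ κ ∧
      ‖fderiv ℝ (minkFrame i) p‖ ≤ κ ∧ ‖fderiv ℝ (fderiv ℝ (minkFrame i)) p‖ ≤ κ := by
  have hb' : ∀ p ∈ N, ‖p‖ < 1 := fun p hp => by simpa using hb hp
  have h0 : ∀ i : Option (Fin n), ∃ C, ∀ p ∈ N, ‖minkFrame i p‖ ≤ C := fun i =>
    hN.exists_bound_of_continuousOn fun p hp =>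
      (contDiffAt_minkFrame (hb' p hp) i).continuousAt.continuousWithinAt
  have h1 : ∀ i : Option (Fin n), ∃ C, ∀ p ∈ N, ‖fderiv ℝ (minkFrame i) p‖ ≤ C := fun i =>
    hN.exists_bound_of_continuousOn fun p hp =>
      ((contDiffAt_minkFrame (hb' p hp) i).fderiv_right (m := 0)
        (by simp)).continuousAt.continuousWithinAt
  have h2 : ∀ i : Option (Fin n), ∃ C, ∀ p ∈ N, ‖fderiv ℝ (fderiv ℝ (minkFrame i)) p‖ ≤ C :=
    fun i => hN.exists_bound_of_continuousOn fun p hp =>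
      (((contDiffAt_minkFrame (hb' p hp) i).fderiv_right (m := 1)
        (WithTop.coe_le_coe.2 (le_top : (1 + 1 : ℕ∞) ≤ ⊤))).fderiv_right (m := 0)
        (by simp)).continuousAt.continuousWithinAt
  choose C0 hC0 using h0
  choose C1 hC1 using h1
  choose C2 hC2 using h2
  refine ⟨∑ i, (|C0 i| + |C1 i| + |C2 i|), fun p hp i => ?_⟩
  have h3 : |C0 i| + |C1 i| + |C2 i| ≤ ∑ i, (|C0 i| + |C1 i| + |C2 i|) :=
    Finset.single_le_sum (f := fun i => |C0 i| + |C1 i| + |C2 i|) (fun i _ => by positivity)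
      (Finset.mem_univ i)
  have a0 := abs_nonneg (C0 i)
  have a1 := abs_nonneg (C1 i)
  have a2 := abs_nonneg (C2 i)
  exact ⟨by linarith [hC0 i p hp, le_abs_self (C0 i)], by linarith [hC1 i p hp, le_abs_self (C1 i)],
    by linarith [hC2 i p hp, le_abs_self (C2 i)]⟩

theorem sum_inner_minkFrame {p : Euc n} (hp : ‖p‖ < 1) (B : Euc n →L[ℝ] Euc n) :
    ∑ i, ⟪minkFrame i p, B (minkFrame i p)⟫ =
      (Real.sqrt (1 - ‖p‖ ^ 2))⁻¹ * ∑ i, ⟪EuclideanSpace.single i 1, B (EuclideanSpace.single i 1)⟫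
        + (Real.sqrt (1 - ‖p‖ ^ 2))⁻¹ ^ 3 * ⟪p, B p⟫ := by
  have h0 := one_sub_norm_sq_pos hp
  have h1 : (1 - ‖p‖ ^ 2) ^ (-(1 / 4) : ℝ) * (1 - ‖p‖ ^ 2) ^ (-(1 / 4) : ℝ)
      = (Real.sqrt (1 - ‖p‖ ^ 2))⁻¹ := by
    rw [← Real.rpow_add h0, Real.sqrt_eq_rpow, ← Real.rpow_neg h0.le]
    norm_num
  have h2 : (1 - ‖p‖ ^ 2) ^ (-(3 / 4) : ℝ) * (1 - ‖p‖ ^ 2) ^ (-(3 / 4) : ℝ)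
      = (Real.sqrt (1 - ‖p‖ ^ 2))⁻¹ ^ 3 := by
    rw [← Real.rpow_add h0, Real.sqrt_eq_rpow, ← Real.rpow_neg h0.le,
      ← Real.rpow_mul_natCast h0.le]
    norm_num
  rw [Fintype.sum_option, add_comm, Finset.mul_sum]
  congr 1
  · refine Finset.sum_congr rfl fun i _ => ?_
    simp only [minkFrame, map_smul, real_inner_smul_left, real_inner_smul_right]
    rw [← mul_assoc, h1]
  · simp only [minkFrame, map_smul, real_inner_smul_left, real_inner_smul_right]
    rw [← mul_assoc, h2]

theorem minkDiv_eq {u : Euc n → ℝ} {x : Euc n} (hd : DifferentiableAt ℝ (gradient u) x)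
    (hp : ‖gradient u x‖ < 1) : MinkDiv u x = ∑ i, ⟪minkFrame i (gradient u x),
      fderiv ℝ (gradient u) x (minkFrame i (gradient u x))⟫ := by
  have h0 := one_sub_norm_sq_pos hp
  have hv : 0 < Real.sqrt (1 - ‖gradient u x‖ ^ 2) := Real.sqrt_pos.2 h0
  have hB := hd.hasFDerivAt
  have hw : HasFDerivAt (fun y => (Real.sqrt (1 - ‖gradient u y‖ ^ 2))⁻¹)
      ((Real.sqrt (1 - ‖gradient u x‖ ^ 2))⁻¹ ^ 3 •
        (innerSL ℝ (gradient u x)).comp (fderiv ℝ (gradient u) x)) x := by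
    have h1 := (((hasFDerivAt_const (1 : ℝ) x).sub hB.norm_sq).sqrt h0.ne')
    have h2 := (hasDerivAt_inv hv.ne').comp_hasFDerivAt x h1
    refine h2.congr_fderiv ?_
    ext w
    simp
    field_simp
  have hc : ∀ i, HasFDerivAt (fun y => gradient u y i)
      ((EuclideanSpace.proj i).comp (fderiv ℝ (gradient u) x)) x := fun i =>
    (EuclideanSpace.proj (𝕜 := ℝ) i).hasFDerivAt.comp x hB
  rw [sum_inner_minkFrame hp, MinkDiv]
  have h3 : ⟪gradient u x, fderiv ℝ (gradient u) x (gradient u x)⟫ =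
      ∑ i, gradient u x i *
        ⟪gradient u x, fderiv ℝ (gradient u) x (EuclideanSpace.single i 1)⟫ := by
    have h4 : fderiv ℝ (gradient u) x (gradient u x) =
        ∑ i, gradient u x i • fderiv ℝ (gradient u) x (EuclideanSpace.single i 1) := by
      conv_lhs => rw [← Euc.sum_single (gradient u x)]
      simp only [map_sum, map_smul]
    rw [h4, inner_sum]
    simp only [real_inner_smul_right]
  rw [h3, Finset.mul_sum, Finset.mul_sum, ← Finset.sum_add_distrib]
  refine Finset.sum_congr rfl fun i _ => ?_
  have h5 : HasFDerivAt (fun y => (Real.sqrt (1 - ‖gradient u y‖ ^ 2))⁻¹ * gradient u y i) _ x :=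
    hw.mul (hc i)
  rw [h5.fderiv]
  simp [EuclideanSpace.inner_single_left]
  ring

end MinkowskiOperator

section CurvatureBounds

variable {n : ℕ}

theorem Matrix.PosSemidef.det_le_trace_div_pow {M : Matrix (Fin n) (Fin n) ℝ} (hn : 0 < n)
    (hM : M.PosSemidef) : M.det ≤ (M.trace / n) ^ n := by
  have hn' : (0 : ℝ) < n := by exact_mod_cast hn
  have h1 := hM.isHermitian.det_eq_prod_eigenvalues
  have h2 := hM.isHermitian.trace_eq_sum_eigenvalues
  have h3 := Real.geom_mean_le_arith_mean Finset.univ (fun _ => (1 : ℝ))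
    hM.isHermitian.eigenvalues (fun _ _ => zero_le_one) (by simpa using hn)
    (fun i _ => hM.eigenvalues_nonneg i)
  simp only [Real.rpow_one, one_mul, Finset.sum_const, Finset.card_univ, Fintype.card_fin,
    nsmul_eq_mul, mul_one] at h3
  have h4 : (0 : ℝ) ≤ ∏ i, hM.isHermitian.eigenvalues i :=
    Finset.prod_nonneg fun i _ => hM.eigenvalues_nonneg i
  simp only [RCLike.ofReal_real_eq_id, id] at h1 h2
  rw [h1, h2]
  have h5 := pow_le_pow_left₀ (Real.rpow_nonneg h4 _) h3 n
  rwa [Real.rpow_inv_natCast_pow h4 hn.ne'] at h5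

theorem fderiv_gradient_apply {u : Euc n → ℝ} {x : Euc n}
    (h : DifferentiableAt ℝ (fderiv ℝ u) x) (v w : Euc n) :
    ⟪fderiv ℝ (gradient u) x v, w⟫ = fderiv ℝ (fderiv ℝ u) x v w := by
  rw [(hasFDerivAt_gradient h).fderiv, ContinuousLinearMap.comp_apply, inner_rieszInv]

theorem det_fderiv_gradient {u : Euc n → ℝ} {x : Euc n}
    (h : DifferentiableAt ℝ (fderiv ℝ u) x) :
    (fderiv ℝ (gradient u) x).det = (Hess u x).det := by
  rw [ContinuousLinearMap.det, ← LinearMap.det_toMatrix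
    (EuclideanSpace.basisFun (Fin n) ℝ).toBasis, ← Matrix.det_transpose]
  congr 1
  ext i j
  rw [hess_eq_of, Matrix.transpose_apply, LinearMap.toMatrix_apply, Matrix.of_apply,
    ← fderiv_gradient_apply h, EuclideanSpace.inner_single_right]
  simp

theorem trace_hess {u : Euc n → ℝ} {x : Euc n} (h : DifferentiableAt ℝ (fderiv ℝ u) x) :
    (Hess u x).trace =
      ∑ i, ⟪EuclideanSpace.single i 1, fderiv ℝ (gradient u) x (EuclideanSpace.single i 1)⟫ := by
  refine Finset.sum_congr rfl fun i _ => ?_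
  rw [real_inner_comm, fderiv_gradient_apply h, hess_eq_of, Matrix.diag_apply, Matrix.of_apply]

theorem trace_hess_le_minkDiv (hn : 0 < n) {u : Euc n → ℝ} {x : Euc n} (h : (Hess u x).PosDef)
    (hp : ‖gradient u x‖ < 1) : (Hess u x).trace ≤ MinkDiv u x := by
  have hd := differentiableAt_fderiv_of_posDef hn h
  have hv : Real.sqrt (1 - ‖gradient u x‖ ^ 2) ≤ 1 :=
    Real.sqrt_le_one.2 (by nlinarith [norm_nonneg (gradient u x)])
  have hv0 : 0 < Real.sqrt (1 - ‖gradient u x‖ ^ 2) := Real.sqrt_pos.2 (one_sub_norm_sq_pos hp)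
  have h1 := (one_le_inv₀ hv0).2 hv
  have h2 : 0 ≤ (Hess u x).trace := h.posSemidef.trace_nonneg
  have h3 : 0 ≤ ⟪gradient u x, fderiv ℝ (gradient u) x (gradient u x)⟫ := by
    rw [real_inner_comm, fderiv_gradient_apply hd, ← dotProduct_hess]
    simpa using h.posSemidef.dotProduct_mulVec_nonneg (fun i => gradient u x i)
  rw [minkDiv_eq (hasFDerivAt_gradient hd).differentiableAt hp, sum_inner_minkFrame hp,
    ← trace_hess hd]
  have h4 : 0 ≤ (Real.sqrt (1 - ‖gradient u x‖ ^ 2))⁻¹ ^ 3 *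
      ⟪gradient u x, fderiv ℝ (gradient u) x (gradient u x)⟫ := by positivity
  nlinarith

theorem exists_hess_le {u : Euc n → ℝ} {x₀ : Euc n} {r : ℝ} (hr : 0 < r)
    (hu : ∀ x ∈ Metric.closedBall x₀ r, ContDiffAt ℝ 2 u x)
    (hlt : ∀ x ∈ Metric.closedBall x₀ r, ‖gradient u x‖ < 1) :
    ∃ x ∈ Metric.closedBall x₀ r, ∀ v, fderiv ℝ (fderiv ℝ u) x v v ≤ 4 / r * ‖v‖ ^ 2 := by
  have hcont : ContinuousOn (fun x => u x - 2 / r * ‖x - x₀‖ ^ 2) (Metric.closedBall x₀ r) :=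
    fun x hx => ((hu x hx).continuousAt.sub (by fun_prop)).continuousWithinAt
  obtain ⟨x, hx, hmax⟩ := (isCompact_closedBall x₀ r).exists_isMaxOn
    (Metric.nonempty_closedBall.2 hr.le) hcont
  have hx₀ : x₀ ∈ Metric.closedBall x₀ r := Metric.mem_closedBall_self hr.le
  have h1 : ‖u x - u x₀‖ ≤ 1 * ‖x - x₀‖ :=
    (convex_closedBall x₀ r).norm_image_sub_le_of_norm_fderiv_le
      (fun z hz => (hu z hz).differentiableAt (by simp))
      (fun z hz => by rw [← norm_gradient]; exact (hlt z hz).le) hx₀ hx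
  have h2 : u x₀ - 2 / r * ‖x₀ - x₀‖ ^ 2 ≤ u x - 2 / r * ‖x - x₀‖ ^ 2 := hmax hx₀
  have h3 : ‖x - x₀‖ < r := by
    rw [mem_closedBall_iff_norm] at hx
    refine lt_of_le_of_ne hx fun h => ?_
    have h4 := (le_abs_self _).trans h1
    rw [h] at h4 h2
    rw [sub_self, norm_zero] at h2
    have h5 : 2 / r * r ^ 2 = 2 * r := by field_simp
    linarith
  refine ⟨x, hx, fun v => ?_⟩
  have hloc : IsLocalMax (fun x => u x - 2 / r * ‖x - x₀‖ ^ 2) x :=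
    hmax.isLocalMax (Metric.closedBall_mem_nhds_of_mem (by simpa [dist_eq_norm] using h3))
  have hj := (hasJet_comp_line (hu x hx) v).sub
    (((hasJet_line (x - x₀) v).norm_sq).const_mul (2 / r))
  have h6 := (hj.isLocalMax ?_).2
  · simp at h6
    linarith [h6, show 4 / r * ‖v‖ ^ 2 = 2 / r * (2 * ‖v‖ ^ 2) by ring]
  · have h7 := hloc.comp_line v
    refine h7.congr (Filter.Eventually.of_forall fun t => ?_)
    simp [sub_add_eq_add_sub]

end CurvatureBounds

section SolutionBounds

variable {n : ℕ} {Ω U : Set (Euc n)} {f : Euc n × Euc n → ℝ} {c : ℝ} {u : Euc n → ℝ}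

theorem IsSmoothSol.posDef (hu : IsSmoothSol Ω U f c u) {x : Euc n} (hx : x ∈ closure Ω) :
    (Hess u x).PosDef := by
  obtain ⟨δ, hδ, h⟩ := hu.2.1
  exact posDef_of_smul_one_le hδ (h x hx)

theorem IsSmoothSol.differentiableAt_fderiv (hn : 0 < n) (hu : IsSmoothSol Ω U f c u) {x : Euc n}
    (hx : x ∈ closure Ω) : DifferentiableAt ℝ (fderiv ℝ u) x :=
  differentiableAt_fderiv_of_posDef hn (hu.posDef hx)

theorem IsSmoothSol.gradient_mem (hu : IsSmoothSol Ω U f c u) {x : Euc n} (hx : x ∈ Ω) :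
    gradient u x ∈ U := by
  rw [← hu.2.2.2.2]
  exact mem_image_of_mem _ hx

theorem exists_curvature_le (hn : 0 < n) (hΩ : IsOpen Ω) (hne : Ω.Nonempty) {κ : ℝ}
    (hκ : ∀ p ∈ closure U, ∀ i, ‖minkFrame i p‖ ≤ κ) (K : ℝ) :
    ∃ C : ℝ, ∀ f c u, (∀ z ∈ closure Ω ×ˢ closure U, |f z| ≤ K) → IsSmoothSol Ω U f c u →
      ∀ x ∈ Ω, f (x, gradient u x) + c ≤ C := by
  obtain ⟨x₀, hx₀⟩ := hne
  obtain ⟨r, hr, hball⟩ := Metric.nhds_basis_closedBall.mem_iff.1 (hΩ.mem_nhds hx₀)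
  refine ⟨2 * K + 4 / r * ∑ _i : Option (Fin n), κ ^ 2, fun f c u hK hu x hx => ?_⟩
  obtain ⟨z, hz, hle⟩ := exists_hess_le hr (u := u) (x₀ := x₀)
    (fun z hz => (hu.1.contDiffAt (Filter.mem_of_superset (hΩ.mem_nhds (hball hz))
      subset_closure)).of_le (WithTop.coe_le_coe.2 (le_top : (2 : ℕ∞) ≤ ⊤)))
    (fun z hz => hu.2.2.1 z (subset_closure (hball hz)))
  have hzΩ := hball hz
  have hd := hu.differentiableAt_fderiv hn (subset_closure hzΩ)
  have h1 := hu.2.2.2.1 z hzΩ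
  rw [minkDiv_eq (hasFDerivAt_gradient hd).differentiableAt
    (hu.2.2.1 z (subset_closure hzΩ))] at h1
  have h2 : ∑ i, ⟪minkFrame i (gradient u z),
      fderiv ℝ (gradient u) z (minkFrame i (gradient u z))⟫ ≤
      4 / r * ∑ _i : Option (Fin n), κ ^ 2 := by
    rw [Finset.mul_sum]
    refine Finset.sum_le_sum fun i _ => ?_
    rw [real_inner_comm, fderiv_gradient_apply hd]
    refine (hle _).trans ?_
    have := hκ _ (subset_closure (hu.gradient_mem hzΩ)) i
    gcongr
  have h3 := abs_le.1 (hK (z, gradient u z)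
    ⟨subset_closure hzΩ, subset_closure (hu.gradient_mem hzΩ)⟩)
  have h4 := abs_le.1 (hK (x, gradient u x)
    ⟨subset_closure hx, subset_closure (hu.gradient_mem hx)⟩)
  linarith [h3.1, h4.2]

theorem IsSmoothSol.volume_le (hn : 0 < n) (hΩ : IsOpen Ω) (hu : IsSmoothSol Ω U f c u) {M : ℝ}
    (hM : ∀ x ∈ Ω, f (x, gradient u x) + c ≤ M) :
    volume U ≤ ENNReal.ofReal ((M / n) ^ n) * volume Ω := by
  have h1 : volume (gradient u '' Ω) ≤
      ∫⁻ x in Ω, ENNReal.ofReal |(fderiv ℝ (gradient u) x).det| :=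
    addHaar_image_le_lintegral_abs_det_fderiv volume hΩ.measurableSet fun x hx =>
      (hasFDerivAt_gradient (hu.differentiableAt_fderiv hn
        (subset_closure hx))).differentiableAt.hasFDerivAt.hasFDerivWithinAt
  rw [hu.2.2.2.2] at h1
  refine h1.trans ?_
  rw [← setLIntegral_const]
  refine setLIntegral_mono measurable_const fun x hx => ENNReal.ofReal_le_ofReal ?_
  have hpd := hu.posDef (subset_closure hx)
  rw [det_fderiv_gradient (hu.differentiableAt_fderiv hn (subset_closure hx)),
    abs_of_pos hpd.det_pos]
  refine (hpd.posSemidef.det_le_trace_div_pow hn).trans ?_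
  have h2 := trace_hess_le_minkDiv hn hpd (hu.2.2.1 x (subset_closure hx))
  rw [hu.2.2.2.1 x hx] at h2
  have h3 := hpd.posSemidef.trace_nonneg
  have h4 := hM x hx
  gcongr
  exact h2.trans h4

theorem IsSmoothSol.le_curvature (hn : 0 < n) (hΩ : IsOpen Ω) (hne : Ω.Nonempty)
    (hb : Bornology.IsBounded Ω) (hosc : OSCcond Ω U f) (hu : IsSmoothSol Ω U f c u) {x : Euc n}
    (hx : x ∈ Ω) : ((n : ℝ) / 2) * ((volume U).toReal / (volume Ω).toReal) ^ ((1 : ℝ) / n) ≤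
      f (x, gradient u x) + c := by
  set ρ := ((volume U).toReal / (volume Ω).toReal) ^ ((1 : ℝ) / n) with hρ
  have hn' : (0 : ℝ) < n := by exact_mod_cast hn
  set M := f (x, gradient u x) + c + n / 2 * ρ with hMdef
  have hM : ∀ z ∈ Ω, f (z, gradient u z) + c ≤ M := fun z hz => by
    have := abs_le.1 (hosc z (subset_closure hz) x (subset_closure hx) _
      (subset_closure (hu.gradient_mem hz)) _ (subset_closure (hu.gradient_mem hx)))
    linarith [this.2]
  have hM0 : 0 ≤ M := by
    refine le_trans ?_ (hM x hx)
    rw [← hu.2.2.2.1 x hx]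
    exact (hu.posDef (subset_closure hx)).posSemidef.trace_nonneg.trans
      (trace_hess_le_minkDiv hn (hu.posDef (subset_closure hx)) (hu.2.2.1 x (subset_closure hx)))
  have hV : 0 < (volume Ω).toReal :=
    ENNReal.toReal_pos (hΩ.measure_pos volume hne).ne' hb.measure_lt_top.ne
  have h1 := ENNReal.toReal_mono
    (ENNReal.mul_ne_top ENNReal.ofReal_ne_top hb.measure_lt_top.ne) (hu.volume_le hn hΩ hM)
  rw [ENNReal.toReal_mul, ENNReal.toReal_ofReal (by positivity), ← div_le_iff₀ hV] at h1
  have h2 : ρ ≤ M / n := by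
    have h3 := Real.rpow_le_rpow (by positivity) h1 (by positivity : (0 : ℝ) ≤ 1 / n)
    rwa [one_div, Real.pow_rpow_inv_natCast (by positivity) hn.ne', ← one_div, ← hρ] at h3
  rw [le_div_iff₀ hn'] at h2
  linarith

end SolutionBounds

section Source

theorem HasJet.nonpos_of_concaveOn {φ : ℝ → ℝ} {a b : ℝ} {s : Set ℝ} (hφ : HasJet φ a b)
    (hs : s ∈ 𝓝 (0 : ℝ)) (hc : ConcaveOn ℝ s φ) : b ≤ 0 := by
  obtain ⟨φ', h1, rfl, h3⟩ := hφ
  have hneg : Filter.Tendsto (fun t : ℝ => -t) (𝓝 0) (𝓝 0) := by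
    simpa using (continuous_neg (G := ℝ)).tendsto 0
  have hj : HasJet (fun t => φ t + φ (-t)) (φ' 0 + -φ' 0) (b + b) := by
    refine ⟨fun t => φ' t + -φ' (-t), ?_, by simp, ?_⟩
    · filter_upwards [h1, hneg.eventually h1] with t ht ht'
      refine HasDerivAt.add ht ?_
      exact (ht'.comp t (hasDerivAt_neg t)).congr_deriv (by simp)
    · refine HasDerivAt.add h3 ?_
      have h4 : HasDerivAt φ' b (-(0 : ℝ)) := by simpa using h3
      exact (h4.comp (0 : ℝ) (hasDerivAt_neg 0)).neg.congr_deriv (by simp)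
  have hmax : IsLocalMax (fun t => φ t + φ (-t)) 0 := by
    filter_upwards [hs, hneg.eventually hs] with t ht ht'
    have h5 := hc.2 ht ht' (by norm_num : (0 : ℝ) ≤ 1 / 2) (by norm_num : (0 : ℝ) ≤ 1 / 2)
      (by norm_num)
    simp only [smul_eq_mul] at h5
    rw [show 1 / 2 * t + 1 / 2 * -t = 0 by ring] at h5
    simp only [neg_zero]
    linarith
  linarith [(hj.isLocalMax hmax).2]

variable {n : ℕ} {Ω U : Set (Euc n)} {f : Euc n × Euc n → ℝ} {ε K : ℝ} {x p : Euc n}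

theorem contDiffAt_of_contDiffOn_prod (hΩ : IsOpen Ω) (hU : IsOpen U)
    (hf : ContDiffOn ℝ 2 f (closure Ω ×ˢ closure U)) (hx : x ∈ Ω) (hp : p ∈ U) :
    ContDiffAt ℝ 2 f (x, p) :=
  hf.contDiffAt (Filter.mem_of_superset ((hΩ.prod hU).mem_nhds (mk_mem_prod hx hp))
    (prod_mono subset_closure subset_closure))

theorem fderiv_partial (hf : DifferentiableAt ℝ f (x, p)) :
    fderiv ℝ (fun x' => f (x', p)) x =
      (fderiv ℝ f (x, p)).comp (ContinuousLinearMap.inl ℝ (Euc n) (Euc n)) := by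
  have h1 : HasFDerivAt (fun x' : Euc n => (x', p)) (ContinuousLinearMap.inl ℝ (Euc n) (Euc n)) x :=
    hasFDerivAt_prodMk_left x p
  exact (hf.hasFDerivAt.comp x h1).fderiv

theorem norm_fderiv_fderiv_mixed_le (hf : ContDiffAt ℝ 2 f (x, p))
    (hε : ‖fderiv ℝ (fun p' => fderiv ℝ (fun x' => f (x', p')) x) p‖ ≤ ε) (a e : Euc n) :
    |fderiv ℝ (fderiv ℝ f) (x, p) (0, e) (a, 0)| ≤ ε * ‖e‖ * ‖a‖ := by
  have hev : ∀ᶠ z in 𝓝 (x, p), DifferentiableAt ℝ f z := by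
    filter_upwards [hf.eventually (by simp)] with z hz using hz.differentiableAt (by simp)
  have h1 : HasFDerivAt (fun p' : Euc n => (x, p'))
      (ContinuousLinearMap.inr ℝ (Euc n) (Euc n)) p := hasFDerivAt_prodMk_right x p
  have h2 : (fun p' => fderiv ℝ (fun x' => f (x', p')) x) =ᶠ[𝓝 p]
      fun p' => (fderiv ℝ f (x, p')).comp (ContinuousLinearMap.inl ℝ (Euc n) (Euc n)) := by
    filter_upwards [h1.continuousAt.eventually hev] with p' hp' using fderiv_partial hp'
  have h3 : DifferentiableAt ℝ (fderiv ℝ f) (x, p) :=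
    (hf.fderiv_right (m := 1) (by norm_num)).differentiableAt (by simp)
  have h4 := ((ContinuousLinearMap.compL ℝ (Euc n) (Euc n × Euc n) ℝ).flip
    (ContinuousLinearMap.inl ℝ (Euc n) (Euc n))).hasFDerivAt.comp p (h3.hasFDerivAt.comp p h1)
  have h5 : fderiv ℝ (fun p' => fderiv ℝ (fun x' => f (x', p')) x) p e a =
      fderiv ℝ (fderiv ℝ f) (x, p) (0, e) (a, 0) := by
    rw [h2.fderiv_eq]
    refine (DFunLike.congr_fun (DFunLike.congr_fun h4.fderiv e) a).trans ?_
    simp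
  rw [← h5, ← Real.norm_eq_abs]
  refine (ContinuousLinearMap.le_opNorm₂ _ e a).trans ?_
  gcongr

theorem fderiv_fderiv_nonpos_of_concaveOn (hΩ : IsOpen Ω) (hf : ContDiffAt ℝ 2 f (x, p))
    (hc : ConcaveOn ℝ (closure Ω) (fun x => f (x, p))) (hx : x ∈ Ω) (a : Euc n) :
    fderiv ℝ (fderiv ℝ f) (x, p) (a, 0) (a, 0) ≤ 0 := by
  refine (hasJet_comp_line hf (a, 0)).nonpos_of_concaveOn
    (s := (fun t : ℝ => x + t • a) ⁻¹' closure Ω) ?_ ?_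
  · refine (by fun_prop : ContinuousAt (fun t : ℝ => x + t • a) 0).preimage_mem_nhds ?_
    simpa using Filter.mem_of_superset (hΩ.mem_nhds hx) subset_closure
  · have h1 := hc.comp_affineMap (AffineMap.lineMap x (x + a))
    have h2 : ((AffineMap.lineMap x (x + a) : ℝ →ᵃ[ℝ] Euc n) : ℝ → Euc n) =
        fun t => x + t • a := by
      ext t
      simp [AffineMap.lineMap_apply, add_comm]
    rw [h2] at h1
    have h3 : (fun t : ℝ => f ((x, p) + t • (a, (0 : Euc n)))) =
        (fun x => f (x, p)) ∘ fun t => x + t • a := by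
      ext t
      simp
    rw [h3]
    exact h1

/-- First and second order information on the source term at an interior point. -/
theorem exists_source_bounds (hΩ : IsOpen Ω) (hU : IsOpen U) (hA : InA Ω U f)
    (hC : C2Bound Ω U f K) (hDx : DxBound Ω U f ε) (hDxp : DxpBound Ω U f ε)
    (hx : x ∈ Ω) (hp : p ∈ U) : ContDiffAt ℝ 2 f (x, p) ∧ ∃ b : Euc n, ‖b‖ ≤ ε ∧
      (∀ a e, ∃ s, |s| ≤ K * ‖e‖ ∧ fderiv ℝ f (x, p) (a, e) = ⟪b, a⟫ + s) ∧
      ∀ a e, fderiv ℝ (fderiv ℝ f) (x, p) (a, e) (a, e) ≤ 2 * (ε * ‖e‖ * ‖a‖) + K * ‖e‖ ^ 2 := by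
  have hf := contDiffAt_of_contDiffOn_prod hΩ hU hA.1 hx hp
  have hx' := subset_closure hx
  have hp' := subset_closure hp
  obtain ⟨-, hK1, hK2⟩ := hC.2 (x, p) ⟨hx', hp'⟩
  have hn : ∀ e : Euc n, ‖((0 : Euc n), e)‖ = ‖e‖ := fun e => by
    simp [Prod.norm_def]
  refine ⟨hf, gradient (fun x' => f (x', p)) x, ?_, fun a e => ?_, fun a e => ?_⟩
  · rw [norm_gradient]
    exact hDx x hx' p hp'
  · refine ⟨fderiv ℝ f (x, p) (0, e), ?_, ?_⟩
    · rw [← Real.norm_eq_abs, ← hn e]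
      exact (ContinuousLinearMap.le_opNorm _ _).trans (by gcongr)
    · rw [inner_gradient, fderiv_partial (hf.differentiableAt (by simp)),
        ContinuousLinearMap.comp_apply, ContinuousLinearMap.inl_apply, ← map_add]
      simp
  · have h1 : ((a, e) : Euc n × Euc n) = (a, 0) + (0, e) := by simp
    have hs := (hf.isSymmSndFDerivAt (by simp)).eq (a, 0) (0, e)
    have h2 : |fderiv ℝ (fderiv ℝ f) (x, p) (0, e) (0, e)| ≤ K * ‖e‖ ^ 2 := by
      have h3 := (iteratedFDeriv ℝ 2 f (x, p)).le_opNorm ![(0, e), (0, e)]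
      rw [iteratedFDeriv_two_apply] at h3
      simp only [Matrix.cons_val_zero, Matrix.cons_val_one, Fin.prod_univ_two, hn,
        Real.norm_eq_abs] at h3
      refine h3.trans ?_
      rw [pow_two]
      gcongr
    have h4 := norm_fderiv_fderiv_mixed_le hf (hDxp x hx' p hp') a e
    have h5 := fderiv_fderiv_nonpos_of_concaveOn hΩ hf (hA.2 p hp') hx a
    rw [h1, map_add, map_add, _root_.add_apply, _root_.add_apply, hs]
    linarith [le_abs_self (fderiv ℝ (fderiv ℝ f) (x, p) (0, e) (a, 0)),
      le_abs_self (fderiv ℝ (fderiv ℝ f) (x, p) (0, e) (0, e))]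

end Source

section DualEquation

theorem clm_apply_fderiv_eq_of_eventually {E F F' : Type*} [NormedAddCommGroup E]
    [NormedSpace ℝ E] [NormedAddCommGroup F] [NormedSpace ℝ F] [NormedAddCommGroup F']
    [NormedSpace ℝ F'] {g : E → F} {y : E} (hg : DifferentiableAt ℝ g y) (L L' : F →L[ℝ] F')
    (h : ∀ᶠ z in 𝓝 y, L (g z) = L' (g z)) (a : E) :
    L (fderiv ℝ g y a) = L' (fderiv ℝ g y a) := by
  have h1 : HasFDerivAt (fun z => L (g z)) _ y := L.hasFDerivAt.comp y hg.hasFDerivAt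
  have h2 : HasFDerivAt (fun z => L' (g z)) _ y := L'.hasFDerivAt.comp y hg.hasFDerivAt
  exact DFunLike.congr_fun (h1.unique (h2.congr_of_eventuallyEq h)) a

variable {n : ℕ} {Ω U : Set (Euc n)} {u ut : Euc n → ℝ} {y : Euc n}

namespace LegendrePair

theorem fderivWithin_eq_fderiv (P : LegendrePair Ω U u ut) (hy : y ∈ U) :
    fderivWithin ℝ (fderiv ℝ (gradient ut)) (closure U) y =
      fderiv ℝ (fderiv ℝ (gradient ut)) y :=
  fderivWithin_of_mem_nhds (Filter.mem_of_superset (P.isOpen_dual.mem_nhds hy) subset_closure)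

theorem inner_fourth_swap (P : LegendrePair Ω U u ut) (hy : y ∈ U) (ξ ς : Euc n) :
    ⟪ξ, fderiv ℝ (fderiv ℝ (fderiv ℝ (gradient ut))) y ς ς ξ⟫ =
      ⟪ς, fderiv ℝ (fderiv ℝ (fderiv ℝ (gradient ut))) y ξ ξ ς⟫ := by
  have hA := P.contDiffAt_hess_dual hy
  have hdd : DifferentiableAt ℝ (fderiv ℝ (fderiv ℝ (gradient ut))) y :=
    (hA.fderiv_right (m := 1)
      (WithTop.coe_le_coe.2 (le_top : (1 + 1 : ℕ∞) ≤ ⊤))).differentiableAt (by simp)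
  have hs : ∀ a b, fderiv ℝ (fderiv ℝ (fderiv ℝ (gradient ut))) y a b =
      fderiv ℝ (fderiv ℝ (fderiv ℝ (gradient ut))) y b a := fun a b =>
    (hA.isSymmSndFDerivAt (by
      rw [minSmoothness_of_isRCLikeNormedField]
      exact WithTop.coe_le_coe.2 (le_top : (2 : ℕ∞) ≤ ⊤))).eq a b
  let ev : Euc n → Euc n → (Euc n →L[ℝ] Euc n →L[ℝ] Euc n) →L[ℝ] Euc n := fun b c =>
    (ContinuousLinearMap.apply ℝ (Euc n) c).comp
      (ContinuousLinearMap.apply ℝ (Euc n →L[ℝ] Euc n) b)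
  let evi : Euc n → Euc n → Euc n → (Euc n →L[ℝ] Euc n →L[ℝ] Euc n) →L[ℝ] ℝ := fun b c d =>
    (innerSL ℝ d).comp ((ContinuousLinearMap.apply ℝ (Euc n) c).comp
      (ContinuousLinearMap.apply ℝ (Euc n →L[ℝ] Euc n) b))
  have hU := P.isOpen_dual.mem_nhds hy
  have hbc : ∀ a b c, fderiv ℝ (fderiv ℝ (fderiv ℝ (gradient ut))) y a b c =
      fderiv ℝ (fderiv ℝ (fderiv ℝ (gradient ut))) y a c b := fun a b c => by
    refine clm_apply_fderiv_eq_of_eventually (F := Euc n →L[ℝ] Euc n →L[ℝ] Euc n)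
      (F' := Euc n) hdd (ev b c) (ev c b) ?_ a
    filter_upwards [hU] with z hz
    have := P.symm_third (subset_closure hz) b c
    rwa [P.fderivWithin_eq_fderiv hz] at this
  have hin : ∀ a b c d, ⟪c, fderiv ℝ (fderiv ℝ (fderiv ℝ (gradient ut))) y a b d⟫ =
      ⟪d, fderiv ℝ (fderiv ℝ (fderiv ℝ (gradient ut))) y a b c⟫ := fun a b c d => by
    refine clm_apply_fderiv_eq_of_eventually (F := Euc n →L[ℝ] Euc n →L[ℝ] Euc n)
      (F' := ℝ) hdd (evi b d c) (evi b c d) ?_ a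
    filter_upwards [hU] with z hz
    have := P.symm_third' (subset_closure hz) b c d
    rw [P.fderivWithin_eq_fderiv hz, real_inner_comm] at this
    exact this.symm
  rw [hbc, hin, hs, hbc, hbc ξ ξ ς]

theorem inner_third_swap (P : LegendrePair Ω U u ut) (hy : y ∈ U) (ξ e : Euc n) :
    ⟪ξ, fderiv ℝ (fderiv ℝ (gradient ut)) y e ξ⟫ =
      ⟪e, fderiv ℝ (fderiv ℝ (gradient ut)) y ξ ξ⟫ := by
  rw [← P.fderivWithin_eq_fderiv hy, P.symm_third (subset_closure hy),
    ← P.symm_third' (subset_closure hy), real_inner_comm]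

theorem nonneg_dual (P : LegendrePair Ω U u ut) (hy : y ∈ closure U) (v : Euc n) :
    0 ≤ ⟪fderiv ℝ (gradient ut) y v, v⟫ := by
  rw [P.inner_hess_dual hy]
  simpa using (P.posDef_dual hy).posSemidef.dotProduct_mulVec_nonneg (fun i => v i)

theorem le_sum_frame (P : LegendrePair Ω U u ut) (hy : y ∈ U) {ι : Type*} [Fintype ι]
    (σ ξ : ι → Euc n) :
    ∑ i, (2 * ⟪ξ i, σ i⟫ - ⟪ξ i, fderiv ℝ (gradient ut) y (ξ i)⟫) ≤
      ∑ i, ⟪σ i, fderiv ℝ (gradient u) (gradient ut y) (σ i)⟫ := by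
  refine Finset.sum_le_sum fun i _ => ?_
  set η := fderiv ℝ (gradient u) (gradient ut y) (σ i) with hη
  have h1 : fderiv ℝ (gradient ut) y η = σ i := P.hess_hess_dual hy _
  have h2 := P.nonneg_dual (subset_closure hy) (η - ξ i)
  have h3 := P.symm_dual (subset_closure hy) (ξ i) η
  rw [map_sub, h1, inner_sub_left, inner_sub_right, inner_sub_right, h3, h1,
    real_inner_comm (ξ i) (σ i)] at h2
  rw [real_inner_comm (fderiv ℝ (gradient ut) y (ξ i)) (ξ i)]
  linarith

end LegendrePair

end DualEquation

section DifferentiatedEquation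

variable {n : ℕ} {Ω U : Set (Euc n)} {f : Euc n × Euc n → ℝ} {c : ℝ} {u ut : Euc n → ℝ}
  {y : Euc n}

namespace LegendrePair

theorem sum_frame_eq (P : LegendrePair Ω U u ut) (hu : IsSmoothSol Ω U f c u) (hy : y ∈ U) :
    ∑ i, ⟪minkFrame i y, fderiv ℝ (gradient u) (gradient ut y) (minkFrame i y)⟫ =
      f (gradient ut y, y) + c := by
  have hx := P.gradient_mem hy
  have h1 := hu.2.2.2.1 _ hx
  rw [minkDiv_eq (P.differentiableAt_gradient (subset_closure hx))
    (hu.2.2.1 _ (subset_closure hx)), P.gradient_gradient (subset_closure hy)] at h1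
  exact h1

/-- First and second order necessary conditions obtained by comparing the dual equation with its
linearization at `y`. -/
theorem differentiated_equation (P : LegendrePair Ω U u ut) (hu : IsSmoothSol Ω U f c u)
    (hy : y ∈ U) (hy1 : ‖y‖ < 1) (hf : ContDiffAt ℝ 2 f (gradient ut y, y))
    {ξ : Option (Fin n) → Euc n}
    (hξ : ∀ i, ξ i = fderiv ℝ (gradient u) (gradient ut y) (minkFrame i y)) (e : Euc n) :
    ∑ i, (2 * ⟪ξ i, fderiv ℝ (minkFrame i) y e⟫ -
        ⟪ξ i, fderiv ℝ (fderiv ℝ (gradient ut)) y e (ξ i)⟫) =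
      fderiv ℝ f (gradient ut y, y) (fderiv ℝ (gradient ut) y e, e) ∧
    ∑ i, (2 * ⟪ξ i, fderiv ℝ (fderiv ℝ (minkFrame i)) y e e⟫ -
        ⟪ξ i, fderiv ℝ (fderiv ℝ (fderiv ℝ (gradient ut))) y e e (ξ i)⟫) ≤
      fderiv ℝ (fderiv ℝ f) (gradient ut y, y) (fderiv ℝ (gradient ut) y e, e)
        (fderiv ℝ (gradient ut) y e, e) +
      fderiv ℝ f (gradient ut y, y) (fderiv ℝ (fderiv ℝ (gradient ut)) y e e, 0) := by
  have h2 : (2 : WithTop ℕ∞) ≤ (⊤ : ℕ∞) := WithTop.coe_le_coe.2 (le_top : (2 : ℕ∞) ≤ ⊤)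
  have hmax : IsLocalMax (fun z => ∑ i, (2 * ⟪ξ i, minkFrame i z⟫ -
      ⟪ξ i, fderiv ℝ (gradient ut) z (ξ i)⟫) - f (gradient ut z, z)) y := by
    filter_upwards [P.isOpen_dual.mem_nhds hy] with z hz
    have h3 := P.le_sum_frame hz (fun i => minkFrame i z) ξ
    rw [P.sum_frame_eq hu hz] at h3
    have h4 : ∑ i, (2 * ⟪ξ i, minkFrame i y⟫ - ⟪ξ i, fderiv ℝ (gradient ut) y (ξ i)⟫) =
        f (gradient ut y, y) + c := by
      rw [← P.sum_frame_eq hu hy]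
      refine Finset.sum_congr rfl fun i _ => ?_
      have h5 : fderiv ℝ (gradient ut) y (ξ i) = minkFrame i y := by
        rw [hξ, P.hess_hess_dual hy]
      rw [h5, ← hξ, real_inner_comm (ξ i) (minkFrame i y)]
      ring
    linarith
  have hjσ : ∀ i, HasJet (fun t : ℝ => 2 * ⟪ξ i, minkFrame i (y + t • e)⟫) _ _ := fun i =>
    ((hasJet_comp_line ((contDiffAt_minkFrame hy1 i).of_le h2) e).inner_const (ξ i)).const_mul 2
  have hjA : ∀ i, HasJet (fun t : ℝ => ⟪ξ i, fderiv ℝ (gradient ut) (y + t • e) (ξ i)⟫) _ _ :=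
    fun i => ((hasJet_comp_line ((P.contDiffAt_hess_dual hy).of_le h2) e).clm
      (ContinuousLinearMap.apply ℝ (Euc n) (ξ i))).inner_const (ξ i)
  have hjz := ((hasJet_comp_line ((P.contDiffAt_gradient_dual hy).of_le h2) e).clm
    (ContinuousLinearMap.inl ℝ (Euc n) (Euc n))).add
    ((hasJet_line y e).clm (ContinuousLinearMap.inr ℝ (Euc n) (Euc n)))
  have hjf := hjz.comp (g := f) (by simpa using hf)
  have hj := (HasJet.sum Finset.univ fun i => (hjσ i).sub (hjA i)).sub hjf
  have h6 := hj.isLocalMax (by simpa using hmax.comp_line e)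
  simp only [ContinuousLinearMap.inl_apply, ContinuousLinearMap.inr_apply, Prod.mk_add_mk,
    add_zero, zero_add, zero_smul, ContinuousLinearMap.apply_apply] at h6
  exact ⟨sub_eq_zero.1 h6.1, sub_nonpos.1 h6.2⟩

end LegendrePair

end DifferentiatedEquation

section DualSolution

variable {n : ℕ} {Ω U : Set (Euc n)} {f : Euc n × Euc n → ℝ} {c : ℝ} {u ut : Euc n → ℝ}
  {y : Euc n}

namespace LegendrePair

theorem le_inner_dual_of_mem (P : LegendrePair Ω U u ut) (hu : IsSmoothSol Ω U f c u) {C : ℝ}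
    (hC : 0 < C) (hle : ∀ x ∈ Ω, f (x, gradient u x) + c ≤ C) (hy : y ∈ U) (hy1 : ‖y‖ < 1)
    (v : Euc n) : C⁻¹ * ‖v‖ ^ 2 ≤ ⟪fderiv ℝ (gradient ut) y v, v⟫ := by
  rcases eq_or_ne v 0 with rfl | hv
  · simp
  have hv0 : 0 < ‖v‖ ^ 2 := by positivity
  set q := ⟪fderiv ℝ (gradient ut) y v, v⟫ with hq
  set t := C / ‖v‖ ^ 2 with ht
  set w := (1 - ‖y‖ ^ 2) ^ (-(1 / 4) : ℝ) with hw
  have hw1 : 1 ≤ w := Real.one_le_rpow_of_pos_of_le_one_of_nonpos (one_sub_norm_sq_pos hy1)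
    (by nlinarith [norm_nonneg y]) (by norm_num)
  have h1 := P.le_sum_frame hy (fun i => minkFrame i y)
    (fun i => i.elim 0 fun j => (t * v j) • v)
  have h2 := hle _ (P.gradient_mem hy)
  rw [P.gradient_gradient (subset_closure hy), ← P.sum_frame_eq hu hy] at h2
  have h3 := h1.trans h2
  rw [Fintype.sum_option] at h3
  have h4 : ∀ i : Fin n, 2 * ⟪(t * v i) • v, minkFrame (some i) y⟫ -
      ⟪(t * v i) • v, fderiv ℝ (gradient ut) y ((t * v i) • v)⟫ =
      (2 * t * w - t ^ 2 * q) * v i ^ 2 := fun i => by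
    rw [hq, hw, real_inner_comm v]
    simp only [minkFrame, map_smul, real_inner_smul_left, real_inner_smul_right,
      EuclideanSpace.inner_single_right]
    simp
    ring
  simp only [Option.elim, inner_zero_left, map_zero, mul_zero, sub_zero, zero_add, h4] at h3
  rw [← Finset.mul_sum, show ∑ i, v i ^ 2 = ‖v‖ ^ 2 by simp [EuclideanSpace.norm_sq_eq]] at h3
  have h5 : t * ‖v‖ ^ 2 = C := by rw [ht]; field_simp
  have ht0 : 0 < t := by positivity
  have h6 : C * (2 * w - t * q) ≤ C * 1 := by
    calc C * (2 * w - t * q) = (2 * t * w - t ^ 2 * q) * ‖v‖ ^ 2 := by rw [← h5]; ring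
      _ ≤ C * 1 := by linarith
  have h7 := le_of_mul_le_mul_left h6 hC
  have h8 : 1 ≤ t * q := by linarith
  have h9 : C⁻¹ * ‖v‖ ^ 2 = t⁻¹ := by rw [ht]; field_simp
  rw [h9, inv_le_iff_one_le_mul₀' ht0]
  exact h8

theorem le_inner_dual (P : LegendrePair Ω U u ut) (hu : IsSmoothSol Ω U f c u) {C : ℝ}
    (hC : 0 < C) (hle : ∀ x ∈ Ω, f (x, gradient u x) + c ≤ C) (hball : ∀ y ∈ U, ‖y‖ < 1)
    (hy : y ∈ closure U) (v : Euc n) : C⁻¹ * ‖v‖ ^ 2 ≤ ⟪fderiv ℝ (gradient ut) y v, v⟫ := by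
  refine le_on_closure (s := U) (f := fun _ => C⁻¹ * ‖v‖ ^ 2)
    (g := fun z => ⟪fderiv ℝ (gradient ut) z v, v⟫)
    (fun z hz => P.le_inner_dual_of_mem hu hC hle hz (hball z hz) v) continuousOn_const ?_ hy
  exact (P.contDiffOn_fderiv.continuousOn.clm_apply continuousOn_const).inner continuousOn_const

theorem dualSol (P : LegendrePair Ω U u ut) (hu : IsSmoothSol Ω U f c u) {C₀ ℓ κ K ε m k : ℝ}
    (hA : InA Ω U f) (hC2 : C2Bound Ω U f K) (hDx : DxBound Ω U f ε) (hDxp : DxpBound Ω U f ε)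
    (hball : ∀ y ∈ U, ‖y‖ < 1) (hC₀ : 0 < C₀) (hle : ∀ x ∈ Ω, f (x, gradient u x) + c ≤ C₀)
    (hℓ : 0 < ℓ) (hge : ∀ x ∈ Ω, ℓ ≤ f (x, gradient u x) + c)
    (hκ : ∀ p ∈ closure U, ∀ i, ‖minkFrame i p‖ ≤ κ ∧
      ‖fderiv ℝ (minkFrame i) p‖ ≤ κ ∧ ‖fderiv ℝ (fderiv ℝ (minkFrame i)) p‖ ≤ κ)
    (hm : 0 < m) (hmC : m ≤ C₀⁻¹) (hmℓ : m * ∑ _i : Option (Fin n), κ ^ 2 ≤ ℓ ^ 2)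
    (hε : 0 ≤ ε) (hk2 : 2 ≤ k) (hk : ∑ _i : Option (Fin n), (κ / m) ^ 2 ≤ k)
    (hk' : ∑ _i : Option (Fin n), κ ^ 2 ≤ k)
    (hk'' : ∑ _i : Option (Fin n), 2 * (κ / m * κ) + K ≤ k) :
    DualSol (Option (Fin n)) U Ω (gradient ut) (fderiv ℝ (gradient ut))
      (fun y => fderivWithin ℝ (fderiv ℝ (gradient ut)) (closure U) y) ε m k where
  hasFDeriv_G y hy := (P.hasFDerivAt_dual hy).differentiableAt.hasFDerivAt.hasFDerivWithinAt
  hasFDeriv_A y hy := P.hasFDerivWithinAt_hess hy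
  symm_T y hy a b c := by rw [P.symm_third hy]
  symm_T' y hy a b c := P.symm_third' hy a b c
  smooth_G y hy := (P.contDiffAt_gradient_dual hy).of_le
    (WithTop.coe_le_coe.2 (le_top : (2 : ℕ∞) ≤ ⊤))
  smooth_A y hy := (P.contDiffAt_hess_dual hy).of_le
    (WithTop.coe_le_coe.2 (le_top : (2 : ℕ∞) ≤ ⊤))
  symm_A y hy v w := P.symm_dual hy v w
  lower_A y hy v := le_trans (by gcongr) (P.le_inner_dual hu hC₀ hle hball hy v)
  maps y hy := P.gradient_mem hy
  maps_frontier y hy := P.gradient_mem_frontier hy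
  pde y hy := by
    have hyc := subset_closure hy
    obtain ⟨hf, b, hb, hf1, hf2⟩ := exists_source_bounds P.isOpen P.isOpen_dual hA hC2 hDx hDxp
      (P.gradient_mem hy) hy
    set ξ : Option (Fin n) → Euc n := fun i =>
      fderiv ℝ (gradient u) (gradient ut y) (minkFrame i y) with hξ
    have hAξ : ∀ i, fderiv ℝ (gradient ut) y (ξ i) = minkFrame i y := fun i =>
      P.hess_hess_dual hy _
    have hκ0 : 0 ≤ κ := (norm_nonneg _).trans (hκ y hyc none).1
    have hξκ : ∀ i, ‖ξ i‖ ≤ κ / m := fun i => by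
      rw [le_div_iff₀ hm]
      rcases (norm_nonneg (ξ i)).eq_or_lt with h0 | h0
      · rw [← h0, zero_mul]
        exact hκ0
      have h1 := P.le_inner_dual hu hC₀ hle hball hyc (ξ i)
      have h2 : m * ‖ξ i‖ ^ 2 ≤ C₀⁻¹ * ‖ξ i‖ ^ 2 := by gcongr
      have h3 := real_inner_le_norm (fderiv ℝ (gradient ut) y (ξ i)) (ξ i)
      rw [hAξ] at h3 h1
      have h4 : ‖ξ i‖ * m * ‖ξ i‖ ≤ ‖minkFrame i y‖ * ‖ξ i‖ := by nlinarith
      exact (le_of_mul_le_mul_right h4 h0).trans (hκ y hyc i).1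
    have hinner : ∀ i (w : Euc n) (r : ℝ), ‖w‖ ≤ κ * r → |⟪ξ i, w⟫| ≤ κ / m * κ * r :=
      fun i w r hw => (abs_real_inner_le_norm _ _).trans
        ((mul_le_mul (hξκ i) hw (norm_nonneg _) (by positivity)).trans_eq (by ring))
    refine ⟨ξ, b, hb, ?_, ?_, ?_, fun e => ?_, fun ς hς => ?_⟩
    · have h1 := hge _ (P.gradient_mem hy)
      rw [P.gradient_gradient hyc, ← P.sum_frame_eq hu hy] at h1
      have h2 : ℓ ≤ ∑ i, κ * ‖ξ i‖ := h1.trans (Finset.sum_le_sum fun i _ =>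
        (real_inner_le_norm _ _).trans (by have := (hκ y hyc i).1; gcongr))
      have h3 := Finset.sum_mul_sq_le_sq_mul_sq Finset.univ
        (fun _ : Option (Fin n) => κ) (fun i => ‖ξ i‖)
      have h4 : ℓ ^ 2 ≤ (∑ i, κ * ‖ξ i‖) ^ 2 := by gcongr
      have h5 : 0 < ∑ _i : Option (Fin n), κ ^ 2 := by
        by_contra! h6
        have h7 : 0 ≤ ∑ i, ‖ξ i‖ ^ 2 := Finset.sum_nonneg fun i _ => by positivity
        nlinarith [pow_pos hℓ 2]
      refine le_of_mul_le_mul_right ?_ h5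
      linarith
    · exact (Finset.sum_le_sum fun i _ => by have := hξκ i; gcongr).trans hk
    · exact (Finset.sum_le_sum fun i _ => by
        rw [hAξ]; have := (hκ y hyc i).1; gcongr).trans hk'
    · have h1 := (P.differentiated_equation hu hy (hball y hy) hf (fun _ => rfl) e).1
      obtain ⟨s, hs, hs'⟩ := hf1 (fderiv ℝ (gradient ut) y e) e
      rw [hs', ← P.symm_dual hyc, ← real_inner_comm _ e, Finset.sum_sub_distrib] at h1
      rw [P.fderivWithin_eq_fderiv hy]
      simp only [P.inner_third_swap hy] at h1
      have h2 : |∑ i, 2 * ⟪ξ i, fderiv ℝ (minkFrame i) y e⟫| ≤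
          ∑ _i : Option (Fin n), 2 * (κ / m * κ) * ‖e‖ :=
        (Finset.abs_sum_le_sum_abs _ _).trans (Finset.sum_le_sum fun i _ => by
          rw [abs_mul, abs_two, mul_assoc]
          have := hinner i (fderiv ℝ (minkFrame i) y e) ‖e‖
            ((fderiv ℝ (minkFrame i) y).le_of_opNorm_le (hκ y hyc i).2.1 e)
          gcongr)
      rw [← Finset.sum_mul] at h2
      have h3 : ∑ i, ⟪e, fderiv ℝ (fderiv ℝ (gradient ut)) y (ξ i) (ξ i)⟫ +
          ⟪e, fderiv ℝ (gradient ut) y b⟫ =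
          ∑ i, 2 * ⟪ξ i, fderiv ℝ (minkFrame i) y e⟫ - s := by
        linarith
      rw [h3]
      have h4 := mul_le_mul_of_nonneg_right hk'' (norm_nonneg e)
      have h5 := abs_sub (∑ i, 2 * ⟪ξ i, fderiv ℝ (minkFrame i) y e⟫) s
      linarith
    · have h1 := (P.differentiated_equation hu hy (hball y hy) hf (fun _ => rfl) ς).2
      obtain ⟨s, hs, hs'⟩ := hf1 (fderiv ℝ (fderiv ℝ (gradient ut)) y ς ς) 0
      have h2 := hf2 (fderiv ℝ (gradient ut) y ς) ς
      rw [norm_zero, mul_zero] at hs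
      have hs0 : s = 0 := abs_nonpos_iff.1 hs
      have h3 : ⟪b, fderiv ℝ (fderiv ℝ (gradient ut)) y ς ς⟫ =
          ⟪ς, fderiv ℝ (fderiv ℝ (gradient ut)) y b ς⟫ := by
        rw [← P.fderivWithin_eq_fderiv hy, ← P.symm_third' hyc, P.symm_third hyc,
          P.symm_third' hyc]
      simp only [P.inner_fourth_swap hy] at h1
      rw [hs', hs0, h3, Finset.sum_sub_distrib] at h1
      rw [P.fderivWithin_eq_fderiv hy]
      have h4 : |∑ i, 2 * ⟪ξ i, fderiv ℝ (fderiv ℝ (minkFrame i)) y ς ς⟫| ≤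
          ∑ _i : Option (Fin n), 2 * (κ / m * κ) :=
        (Finset.abs_sum_le_sum_abs _ _).trans (Finset.sum_le_sum fun i _ => by
          rw [abs_mul, abs_two]
          have h5 := (fderiv ℝ (fderiv ℝ (minkFrame i)) y).le_opNorm₂ ς ς
          rw [hς, mul_one, mul_one] at h5
          have := hinner i _ 1 (by rw [mul_one]; exact h5.trans (hκ y hyc i).2.2)
          rw [mul_one] at this
          gcongr)
      have h5 : 2 * (ε * ‖fderiv ℝ (gradient ut) y ς‖) ≤
          k * (ε * ‖fderiv ℝ (gradient ut) y ς‖) := by gcongr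
      have h6 := (abs_le.1 h4).1
      rw [hς] at h2
      linarith

end LegendrePair

end DualSolution

theorem statement_16 {n : ℕ} (hn : 2 ≤ n)
    (Ω Ωt : Set (Euc n)) (ht h : Euc n → ℝ) (θt θ : ℝ)
    (hdom : DomainSetup Ω Ωt ht h θt θ)
    (hball : closure Ωt ⊆ Metric.ball (0 : Euc n) 1)
    :
    ∀ K : ℝ, 0 < K →
      ∃ ε C₂₇ : ℝ, 0 < ε ∧ 0 < C₂₇ ∧
        ∀ f : Euc n × Euc n → ℝ, InA Ω Ωt f → C2Bound Ω Ωt f K → OSCcond Ω Ωt f →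
          DxBound Ω Ωt f ε → DxpBound Ω Ωt f ε →
        ∀ (c : ℝ) (u ut : Euc n → ℝ), IsSmoothSol Ω Ωt f c u → IsLegendre Ω Ωt u ut →
        ∀ y ∈ frontier Ωt, ∀ ς : Euc n, ‖ς‖ = 1 → ⟪ς, gradient h y⟫ = 0 →
          (fun i => ς i) ⬝ᵥ (Hess ut y).mulVec (fun i => ς i) ≤ C₂₇ := by
  intro K _
  obtain ⟨hΩ, hΩt, hbΩ, hbΩt, hneΩ, hneΩt, hht, hh, hΩeq, hΩteq, hunitt, hunit, hθt, hθ, hconct,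
    hconc⟩ := hdom
  have hn0 : 0 < n := by omega
  obtain ⟨κ, hκ⟩ := exists_bound_minkFrame hbΩt.isCompact_closure hball
  obtain ⟨C, hC⟩ := exists_curvature_le hn0 hΩ hneΩ (fun p hp i => (hκ p hp i).1) K
  obtain ⟨k₁, hk₁⟩ := exists_barrier hbΩt hh hΩteq hunit hconc
  obtain ⟨k₂, hk₂⟩ := exists_barrier hbΩ hht hΩeq hunitt hconct
  have hvol : ∀ S : Set (Euc n), IsOpen S → Bornology.IsBounded S → S.Nonempty →
      0 < (volume S).toReal := fun S h1 h2 h3 =>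
    ENNReal.toReal_pos (h1.measure_pos volume h3).ne' h2.measure_lt_top.ne
  set ℓ := ((n : ℝ) / 2) * ((volume Ωt).toReal / (volume Ω).toReal) ^ ((1 : ℝ) / n)
  have hℓ0 : 0 < ℓ := by
    have h1 := hvol Ω hΩ hbΩ hneΩ
    have h2 := hvol Ωt hΩt hbΩt hneΩt
    have h3 : (0 : ℝ) < n := by exact_mod_cast hn0
    positivity
  set C₀ := max C 1
  have hC₀ : 0 < C₀ := one_pos.trans_le (le_max_right _ _)
  set S := ∑ _i : Option (Fin n), κ ^ 2
  have hS : 0 ≤ S := Finset.sum_nonneg fun _ _ => sq_nonneg κ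
  obtain ⟨m, hm, hmθ, hmθt, hmC, hmℓ⟩ : ∃ m : ℝ, 0 < m ∧ m ≤ θ ∧ m ≤ θt ∧ m ≤ C₀⁻¹ ∧
      m * S ≤ ℓ ^ 2 := by
    refine ⟨min (min θ θt) (min C₀⁻¹ (ℓ ^ 2 / (S + 1))), ?_, ?_, ?_, ?_, ?_⟩
    · have : 0 < ℓ ^ 2 / (S + 1) := by positivity
      exact lt_min (lt_min hθ hθt) (lt_min (inv_pos.2 hC₀) this)
    · exact (min_le_left _ _).trans (min_le_left _ _)
    · exact (min_le_left _ _).trans (min_le_right _ _)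
    · exact (min_le_right _ _).trans (min_le_left _ _)
    · calc _ ≤ ℓ ^ 2 / (S + 1) * S :=
            mul_le_mul_of_nonneg_right ((min_le_right _ _).trans (min_le_right _ _)) hS
        _ ≤ ℓ ^ 2 := by
            rw [div_mul_eq_mul_div, div_le_iff₀ (by positivity)]
            nlinarith [sq_nonneg ℓ]
  obtain ⟨k, hkk₁, hkk₂, hk2, hk, hk', hk''⟩ : ∃ k : ℝ, k₁ ≤ k ∧ k₂ ≤ k ∧ 2 ≤ k ∧
      ∑ _i : Option (Fin n), (κ / m) ^ 2 ≤ k ∧ S ≤ k ∧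
      ∑ _i : Option (Fin n), 2 * (κ / m * κ) + K ≤ k := by
    have hfin : ({k₁, k₂, 2, ∑ _i : Option (Fin n), (κ / m) ^ 2, S,
      ∑ _i : Option (Fin n), 2 * (κ / m * κ) + K} : Set ℝ).Finite := Set.toFinite _
    obtain ⟨k, hk⟩ := hfin.bddAbove
    exact ⟨k, hk (by simp), hk (by simp), hk (by simp), hk (by simp), hk (by simp), hk (by simp)⟩
  obtain ⟨ε, C', hε, hC', hmain⟩ := exists_tangential_bound (Option (Fin n)) (hk₁ k hkk₁)
    (hk₂ k hkk₂) hm hmθ hmθt (one_le_two.trans hk2)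
  refine ⟨ε, C', hε, hC', fun f hA hC2 hosc hDx hDxp c u ut hu hut y hy ς hς hςν => ?_⟩
  have P := LegendrePair.of_isSmoothSol hn0 hΩ hΩt hbΩ.isCompact_closure
    ((hk₁ k hkk₁).uniqueDiffOn hθ.le hneΩt) hu hut
  have D := P.dualSol hu hA hC2 hDx hDxp (fun z hz => by simpa using hball (subset_closure hz)) hC₀
    (fun x hx => (hC f c u (fun z hz => (hC2.2 z hz).1) hu x hx).trans (le_max_left _ _)) hℓ0
    (fun x hx => hu.le_curvature hn0 hΩ hneΩ hbΩ hosc hx) hκ hm hmC hmℓ hε.le hk2 hk hk' hk''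
  rw [← P.inner_hess_dual (frontier_subset_closure hy), real_inner_comm]
  exact hmain _ _ _ D y hy ς hς hςν

end
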